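/- arXiv:2006.02585 — 15 statements merged into one kernel-verified Lean document; each statement's English description precedes it below -/
import Mathlib

section
/- Regret bound for dual-stabilized OMD (Theorem 1). Let η : ℕ → ℝ_{>0} be nonincreasing and set γ_t := η_{t+1}/η_t ∈ (0,1]. Let {f_t}_{t≥1} be convex functions f_t : X → ℝ. Suppose sequences {x_t}_{t≥1} ⊆ X ∩ D, {w_t}_{t≥2} ⊆ D, {y_t}_{t≥2} ⊆ D and {g_t}_{t≥1} ⊆ ℝⁿ satisfy, for every t ≥ 1: g_t is a subgradient of f_t at x_t on X; ∇Φ(w_{t+1}) = ∇Φ(x_t) − η_t g_t; ∇Φ(y_{t+1}) = γ_t ∇Φ(w_{t+1}) + (1−γ_t) ∇Φ(x_1); and x_{t+1} ∈ X ∩ D satisfies D_Φ(x_{t+1}, y_{t+1}) ≤ D_Φ(x, y_{t+1}) for all x ∈ X. Then for every T ≥ 1 and every z ∈ X: Σ_{t=1}^T (f_t(x_t) − f_t(z)) ≤ Σ_{t=1}^T (D_Φ(x_t, w_{t+1}) − D_Φ(x_{t+1}, w_{t+1}))/η_t + D_Φ(z, x_1)/η_{T+1}. -/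
/-!
Regret bound for dual-stabilized OMD (Theorem 1 of
"Online mirror descent and dual averaging: keeping pace in the dynamic case").
-/

open scoped RealInnerProductSpace BigOperators

/-- Bregman divergence `D_Φ(x,y) = Φ(x) − Φ(y) − ⟨∇Φ(y), x − y⟩`, where `Φ'`
denotes the gradient map of `Φ`. -/
noncomputable def bregman {n : ℕ} (Φ : EuclideanSpace ℝ (Fin n) → ℝ)
    (Φ' : EuclideanSpace ℝ (Fin n) → EuclideanSpace ℝ (Fin n))
    (x y : EuclideanSpace ℝ (Fin n)) : ℝ :=
  Φ x - Φ y - ⟪Φ' y, x - y⟫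

lemma aux_slope {n : ℕ} (Φ : EuclideanSpace ℝ (Fin n) → ℝ)
    (G p v : EuclideanSpace ℝ (Fin n)) (h : HasGradientAt Φ G p) :
    Filter.Tendsto (fun s : ℝ => s⁻¹ * (Φ (p + s • v) - Φ p)) (nhdsWithin 0 (Set.Ioi 0))
      (nhds ⟪G, v⟫) := by
  have h1 : HasLineDerivAt ℝ Φ ⟪G, v⟫ p v := by
    simpa using h.hasFDerivAt.hasLineDerivAt v
  simpa using h1.tendsto_slope_zero_right

lemma aux_ge {n : ℕ} (Φ : EuclideanSpace ℝ (Fin n) → ℝ)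
    (G p v : EuclideanSpace ℝ (Fin n)) (h : HasGradientAt Φ G p) (c : ℝ)
    (hc : ∀ s : ℝ, 0 < s → s < 1 → s * c ≤ Φ (p + s • v) - Φ p) : c ≤ ⟪G, v⟫ := by
  refine ge_of_tendsto (aux_slope Φ G p v h) ?_
  filter_upwards [Ioo_mem_nhdsGT (zero_lt_one (α := ℝ))] with s hs
  rw [le_inv_mul_iff₀ hs.1]
  exact hc s hs.1 hs.2

lemma aux_le {n : ℕ} (Φ : EuclideanSpace ℝ (Fin n) → ℝ)
    (G p v : EuclideanSpace ℝ (Fin n)) (h : HasGradientAt Φ G p) (c : ℝ)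
    (hc : ∀ s : ℝ, 0 < s → s < 1 → Φ (p + s • v) - Φ p ≤ s * c) : ⟪G, v⟫ ≤ c := by
  refine le_of_tendsto (aux_slope Φ G p v h) ?_
  filter_upwards [Ioo_mem_nhdsGT (zero_lt_one (α := ℝ))] with s hs
  rw [inv_mul_le_iff₀ hs.1]
  exact hc s hs.1 hs.2

lemma aux_nonneg {n : ℕ} (C : Set (EuclideanSpace ℝ (Fin n)))
    (Φ : EuclideanSpace ℝ (Fin n) → ℝ)
    (Φ' : EuclideanSpace ℝ (Fin n) → EuclideanSpace ℝ (Fin n))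
    (hΦ : ConvexOn ℝ C Φ) (z p : EuclideanSpace ℝ (Fin n)) (hz : z ∈ C) (hp : p ∈ C)
    (h : HasGradientAt Φ (Φ' p) p) : 0 ≤ bregman Φ Φ' z p := by
  have := aux_le Φ (Φ' p) p (z - p) h (Φ z - Φ p) (by
    intro s h0 h1
    have := hΦ.2 hp hz (by linarith : 0 ≤ 1 - s) h0.le (by ring)
    have e : p + s • (z - p) = (1 - s) • p + s • z := by module
    rw [e]
    simp only [smul_eq_mul] at this
    linarith)
  unfold bregman
  linarith

lemma aux_opt {n : ℕ} (X : Set (EuclideanSpace ℝ (Fin n)))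
    (Φ : EuclideanSpace ℝ (Fin n) → ℝ)
    (Φ' : EuclideanSpace ℝ (Fin n) → EuclideanSpace ℝ (Fin n))
    (hX : Convex ℝ X) (z p q : EuclideanSpace ℝ (Fin n)) (hz : z ∈ X) (hp : p ∈ X)
    (h : HasGradientAt Φ (Φ' p) p)
    (hm : ∀ u ∈ X, bregman Φ Φ' p q ≤ bregman Φ Φ' u q) :
    ⟪Φ' q, z - p⟫ ≤ ⟪Φ' p, z - p⟫ := by
  refine aux_ge Φ (Φ' p) p (z - p) h _ ?_
  intro s h0 h1
  have h2 := hm _ (hX.add_smul_sub_mem hp hz ⟨h0.le, h1.le⟩)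
  unfold bregman at h2
  have e : p + s • (z - p) - q = (p - q) + s • (z - p) := by abel
  rw [e, inner_add_right, inner_smul_right] at h2
  linarith

theorem ds_omd_regret_bound {n : ℕ}
    (D X : Set (EuclideanSpace ℝ (Fin n)))
    (Φ : EuclideanSpace ℝ (Fin n) → ℝ)
    (Φ' : EuclideanSpace ℝ (Fin n) → EuclideanSpace ℝ (Fin n))
    -- mirror map setup
    (hDopen : IsOpen D) (hDconv : Convex ℝ D) (hDne : D.Nonempty)
    (hΦconv : ConvexOn ℝ (closure D) Φ)
    (hΦstrict : StrictConvexOn ℝ D Φ)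
    (hΦgrad : ∀ y ∈ D, HasGradientAt Φ (Φ' y) y)
    (hΦbij : Set.BijOn Φ' D Set.univ)
    (hXclosed : IsClosed X) (hXconv : Convex ℝ X)
    (hXsub : X ⊆ closure D) (hXDne : (X ∩ D).Nonempty)
    -- learning rates and stabilization parameters
    (η : ℕ → ℝ) (hη : ∀ t, 0 < η t) (hηmono : ∀ t, η (t + 1) ≤ η t)
    (γ : ℕ → ℝ) (hγ : ∀ t, γ t = η (t + 1) / η t)
    -- cost functions
    (f : ℕ → EuclideanSpace ℝ (Fin n) → ℝ)
    (hfconv : ∀ t, 1 ≤ t → ConvexOn ℝ X (f t))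
    -- iterates of dual-stabilized OMD
    (x w y g : ℕ → EuclideanSpace ℝ (Fin n))
    (hx : ∀ t, 1 ≤ t → x t ∈ X ∩ D)
    (hw : ∀ t, 2 ≤ t → w t ∈ D)
    (hy : ∀ t, 2 ≤ t → y t ∈ D)
    (hsubgrad : ∀ t, 1 ≤ t → ∀ z ∈ X, f t (x t) + ⟪g t, z - x t⟫ ≤ f t z)
    (hwstep : ∀ t, 1 ≤ t → Φ' (w (t + 1)) = Φ' (x t) - η t • g t)
    (hystep : ∀ t, 1 ≤ t →
      Φ' (y (t + 1)) = γ t • Φ' (w (t + 1)) + (1 - γ t) • Φ' (x 1))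
    (hproj : ∀ t, 1 ≤ t → ∀ u ∈ X,
      bregman Φ Φ' (x (t + 1)) (y (t + 1)) ≤ bregman Φ Φ' u (y (t + 1))) :
    ∀ T, 1 ≤ T → ∀ z ∈ X,
      ∑ t ∈ Finset.Icc 1 T, (f t (x t) - f t z) ≤
        ∑ t ∈ Finset.Icc 1 T,
          (bregman Φ Φ' (x t) (w (t + 1)) - bregman Φ Φ' (x (t + 1)) (w (t + 1))) / η t
        + bregman Φ Φ' z (x 1) / η (T + 1) := by
  intro T _ z hz
  have hstep : ∀ t, 1 ≤ t → f t (x t) - f t z ≤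
      (bregman Φ Φ' (x t) (w (t + 1)) - bregman Φ Φ' (x (t + 1)) (w (t + 1))) / η t
      + (bregman Φ Φ' z (x 1) / η (t + 1) - bregman Φ Φ' z (x 1) / η t)
      + (bregman Φ Φ' z (x t) / η t - bregman Φ Φ' z (x (t + 1)) / η (t + 1)) := by
    intro t ht
    have ha := hη t
    have hb := hη (t + 1)
    have hab := hηmono t
    have hxt := hx (t + 1) (by omega)
    have h1 := hsubgrad t ht z hz
    have hopt := aux_opt X Φ Φ' hXconv z (x (t + 1)) (y (t + 1)) hz hxt.1
      (hΦgrad _ hxt.2) (hproj t ht)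
    have hnn := aux_nonneg (closure D) Φ Φ' hΦconv (x (t + 1)) (x 1) (subset_closure hxt.2)
      (subset_closure (hx 1 le_rfl).2) (hΦgrad _ (hx 1 le_rfl).2)
    have hg : η t * ⟪g t, z - x t⟫ = -(bregman Φ Φ' z (x t) - bregman Φ Φ' z (w (t + 1))
        + bregman Φ Φ' (x t) (w (t + 1))) := by
      have : η t * ⟪g t, z - x t⟫ = ⟪Φ' (x t) - Φ' (w (t + 1)), z - x t⟫ := by
        rw [hwstep t ht, sub_sub_cancel, real_inner_smul_left]
      rw [this]
      simp only [bregman, inner_sub_left, inner_sub_right]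
      ring
    have e1 : ∀ q, ⟪Φ' (x (t + 1)), z - x (t + 1)⟫ - ⟪Φ' q, z - x (t + 1)⟫
        = bregman Φ Φ' z q - bregman Φ Φ' z (x (t + 1)) - bregman Φ Φ' (x (t + 1)) q := by
      intro q
      simp only [bregman, inner_sub_right]
      ring
    rw [hystep t ht, inner_add_left, real_inner_smul_left, real_inner_smul_left, hγ t] at hopt
    have ew := e1 (w (t + 1))
    have ex := e1 (x 1)
    generalize bregman Φ Φ' z (x t) = A at *
    generalize bregman Φ Φ' z (x (t + 1)) = B at *
    generalize bregman Φ Φ' z (w (t + 1)) = C at *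
    generalize bregman Φ Φ' z (x 1) = E at *
    generalize bregman Φ Φ' (x t) (w (t + 1)) = F at *
    generalize bregman Φ Φ' (x (t + 1)) (w (t + 1)) = H at *
    generalize bregman Φ Φ' (x (t + 1)) (x 1) = K at *
    generalize (⟪Φ' (x (t + 1)), z - x (t + 1)⟫ : ℝ) = P at *
    generalize (⟪Φ' (w (t + 1)), z - x (t + 1)⟫ : ℝ) = Q at *
    generalize (⟪Φ' (x 1), z - x (t + 1)⟫ : ℝ) = R at *
    generalize (⟪g t, z - x t⟫ : ℝ) = I at *
    generalize η t = a at *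
    generalize η (t + 1) = b at *
    have hI : I = -(A - C + F) / a := by rw [← hg]; field_simp
    have hK : 0 ≤ (1 / b - 1 / a) * K :=
      mul_nonneg (sub_nonneg.2 (one_div_le_one_div_of_le hb hab)) hnn
    have hQ : Q = P - (C - B - H) := by linarith
    have hR : R = P - (E - B - K) := by linarith
    subst hQ hR
    have h3 : 0 ≤ (1 / b) * (P - (b / a * (P - (C - B - H)) + (1 - b / a) * (P - (E - B - K)))) :=
      mul_nonneg (by positivity) (by linarith)
    have h4 : (1 / b) * (P - (b / a * (P - (C - B - H)) + (1 - b / a) * (P - (E - B - K))))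
        = (C - H) / a + (E / b - E / a) - B / b - (1 / b - 1 / a) * K := by
      field_simp
      ring
    have h5 : -(A - C + F) / a = - (A / a) + (C - H) / a - (F - H) / a := by ring
    linarith
  have hsum : ∀ S : ℕ, ∑ t ∈ Finset.Icc 1 S, (f t (x t) - f t z) ≤
      ∑ t ∈ Finset.Icc 1 S,
        (bregman Φ Φ' (x t) (w (t + 1)) - bregman Φ Φ' (x (t + 1)) (w (t + 1))) / η t
      + bregman Φ Φ' z (x 1) / η (S + 1) - bregman Φ Φ' z (x (S + 1)) / η (S + 1) := by
    intro S
    induction S with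
    | zero => simp
    | succ k ih =>
      rw [Finset.sum_Icc_succ_top (by omega), Finset.sum_Icc_succ_top (by omega)]
      have := hstep (k + 1) (by omega)
      linarith
  have hT := hsum T
  have hxT := hx (T + 1) (by omega)
  have hnn := aux_nonneg (closure D) Φ Φ' hΦconv z (x (T + 1)) (hXsub hz)
    (subset_closure hxT.2) (hΦgrad _ hxT.2)
  have := div_nonneg hnn (hη (T + 1)).le
  linarith
end

section
/- Per-round inequality for dual-stabilized OMD (Claim 1). Let η_t, η_{t+1} > 0 with η_{t+1} ≤ η_t and γ_t := η_{t+1}/η_t ∈ (0,1]. Let x_t, x_1 ∈ X ∩ D, w_{t+1}, y_{t+1} ∈ D with ∇Φ(y_{t+1}) = γ_t ∇Φ(w_{t+1}) + (1−γ_t) ∇Φ(x_1), and let x_{t+1} ∈ X ∩ D satisfy D_Φ(x_{t+1}, y_{t+1}) ≤ D_Φ(x, y_{t+1}) for all x ∈ X. Then for every z ∈ X: (1/η_t)·(D_Φ(x_t, w_{t+1}) − D_Φ(z, w_{t+1}) + D_Φ(z, x_t)) ≤ (D_Φ(x_t, w_{t+1}) − D_Φ(x_{t+1}, w_{t+1}))/η_t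 + (1/η_{t+1} − 1/η_t)·D_Φ(z, x_1) + D_Φ(z, x_t)/η_t − D_Φ(z, x_{t+1})/η_{t+1}. -/
/-! Per-round inequality for dual-stabilized OMD (Claim 1). -/

open scoped RealInnerProductSpace BigOperators

theorem line_deriv_aux {n : ℕ} {Φ : EuclideanSpace ℝ (Fin n) → ℝ}
    {g x : EuclideanSpace ℝ (Fin n)} (h : HasGradientAt Φ g x)
    (z : EuclideanSpace ℝ (Fin n)) :
    HasDerivAt (fun t : ℝ => Φ (AffineMap.lineMap x z t)) ⟪g, z - x⟫ 0 := by
  have h1 : HasDerivAt (fun t : ℝ => AffineMap.lineMap x z t) (z - x) (0 : ℝ) :=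
    AffineMap.hasDerivAt_lineMap
  have h2 : HasFDerivAt Φ (InnerProductSpace.toDual ℝ _ g) (AffineMap.lineMap x z (0 : ℝ)) := by
    simpa using h.hasFDerivAt
  simpa [Function.comp_def] using h2.comp_hasDerivAt (0 : ℝ) h1

theorem bregman_nonneg_aux {n : ℕ} {D : Set (EuclideanSpace ℝ (Fin n))}
    {Φ : EuclideanSpace ℝ (Fin n) → ℝ} {g x z : EuclideanSpace ℝ (Fin n)}
    (hc : ConvexOn ℝ D Φ) (h : HasGradientAt Φ g x) (hx : x ∈ D) (hz : z ∈ D) :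
    ⟪g, z - x⟫ ≤ Φ z - Φ x := by
  have h1 := hc.comp_affineMap (AffineMap.lineMap (k := ℝ) x z)
  have h2 := h1.le_slope_of_hasDerivAt (x := 0) (y := 1) (by simpa using hx) (by simpa using hz)
    one_pos (line_deriv_aux h z)
  simpa [slope_def_field] using h2

theorem opt_aux {n : ℕ} {X : Set (EuclideanSpace ℝ (Fin n))}
    {Φ : EuclideanSpace ℝ (Fin n) → ℝ} {g v x z : EuclideanSpace ℝ (Fin n)}
    (hX : Convex ℝ X) (h : HasGradientAt Φ g x) (hx : x ∈ X) (hz : z ∈ X)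
    (hmin : ∀ u ∈ X, Φ x - ⟪v, x⟫ ≤ Φ u - ⟪v, u⟫) :
    ⟪v, z - x⟫ ≤ ⟪g, z - x⟫ := by
  have h1 : HasFDerivAt (fun u => Φ u - ⟪v, u⟫)
      (InnerProductSpace.toDual ℝ _ g - innerSL ℝ v) x :=
    h.hasFDerivAt.sub (innerSL ℝ v).hasFDerivAt
  have h2 : IsLocalMinOn (fun u => Φ u - ⟪v, u⟫) X x :=
    IsMinOn.localize (isMinOn_iff.2 hmin)
  have h3 := h2.hasFDerivWithinAt_nonneg h1.hasFDerivWithinAt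
    (sub_mem_posTangentConeAt_of_segment_subset (hX.segment_subset hx hz))
  simpa using h3

theorem ds_omd_per_round {n : ℕ}
    (D X : Set (EuclideanSpace ℝ (Fin n)))
    (Φ : EuclideanSpace ℝ (Fin n) → ℝ)
    (Φ' : EuclideanSpace ℝ (Fin n) → EuclideanSpace ℝ (Fin n))
    -- mirror map setup
    (hDopen : IsOpen D) (hDconv : Convex ℝ D) (hDne : D.Nonempty)
    (hΦconv : ConvexOn ℝ (closure D) Φ)
    (hΦstrict : StrictConvexOn ℝ D Φ)
    (hΦgrad : ∀ y ∈ D, HasGradientAt Φ (Φ' y) y)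
    (hΦbij : Set.BijOn Φ' D Set.univ)
    (hXclosed : IsClosed X) (hXconv : Convex ℝ X)
    (hXsub : X ⊆ closure D) (hXDne : (X ∩ D).Nonempty)
    -- learning rates
    (ηt ηt1 : ℝ) (hηt : 0 < ηt) (hηt1 : 0 < ηt1) (hmono : ηt1 ≤ ηt)
    (γt : ℝ) (hγt : γt = ηt1 / ηt)
    -- iterates
    (x1 xt xnext : EuclideanSpace ℝ (Fin n)) (wnext ynext : EuclideanSpace ℝ (Fin n))
    (hx1 : x1 ∈ X ∩ D) (hxt : xt ∈ X ∩ D)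
    (hwnext : wnext ∈ D) (hynext : ynext ∈ D)
    (hystep : Φ' ynext = γt • Φ' wnext + (1 - γt) • Φ' x1)
    (hxnext : xnext ∈ X ∩ D)
    (hproj : ∀ u ∈ X, bregman Φ Φ' xnext ynext ≤ bregman Φ Φ' u ynext) :
    ∀ z ∈ X,
      (1 / ηt) * (bregman Φ Φ' xt wnext - bregman Φ Φ' z wnext + bregman Φ Φ' z xt) ≤
        (bregman Φ Φ' xt wnext - bregman Φ Φ' xnext wnext) / ηt
        + (1 / ηt1 - 1 / ηt) * bregman Φ Φ' z x1
        + bregman Φ Φ' z xt / ηt - bregman Φ Φ' z xnext / ηt1 := by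
  intro z hz
  have hopt := opt_aux (v := Φ' ynext) hXconv (hΦgrad _ hxnext.2) hxnext.1 hz (by
    intro u hu
    have := hproj u hu
    simp only [bregman, inner_sub_right] at this
    linarith)
  have hnn := bregman_nonneg_aux hΦstrict.convexOn (hΦgrad _ hx1.2) hx1.2 hxnext.2
  rw [hystep] at hopt
  simp only [inner_add_left, real_inner_smul_left] at hopt
  have hγ1 : 0 ≤ 1 - γt := by
    rw [hγt, sub_nonneg, div_le_one hηt]; exact hmono
  have key : bregman Φ Φ' z xnext ≤ γt * (bregman Φ Φ' z wnext - bregman Φ Φ' xnext wnext)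
      + (1 - γt) * bregman Φ Φ' z x1 := by
    have := mul_nonneg hγ1 (sub_nonneg.2 hnn)
    simp only [bregman, inner_sub_right] at *
    linarith
  have key2 := div_le_div_of_nonneg_right key hηt1.le
  have e : (γt * (bregman Φ Φ' z wnext - bregman Φ Φ' xnext wnext)
      + (1 - γt) * bregman Φ Φ' z x1) / ηt1
      = (bregman Φ Φ' z wnext - bregman Φ Φ' xnext wnext) / ηt
      + (1 / ηt1 - 1 / ηt) * bregman Φ Φ' z x1 := by
    rw [hγt]; field_simp
  rw [e] at key2
  have e2 : (1 / ηt) * (bregman Φ Φ' xt wnext - bregman Φ Φ' z wnext + bregman Φ Φ' z xt)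
      = (bregman Φ Φ' xt wnext - bregman Φ Φ' xnext wnext) / ηt
      - (bregman Φ Φ' z wnext - bregman Φ Φ' xnext wnext) / ηt + bregman Φ Φ' z xt / ηt := by
    ring
  rw [e2]
  linarith
end

section
/- Regret bound for primal-stabilized OMD (Theorem 2). Let η : ℕ → ℝ_{>0} be nonincreasing and set γ_t := η_{t+1}/η_t ∈ (0,1]. Let {f_t}_{t≥1} be convex functions f_t : X → ℝ. Assume that for every z ∈ X the map y ↦ D_Φ(z, y) is convex on X ∩ D. Suppose sequences {x_t}_{t≥1} ⊆ X ∩ D, {w_t}_{t≥2} ⊆ D, {y_t}_{t≥2} ⊆ X ∩ D and {g_t}_{t≥1} ⊆ ℝⁿ satisfy, for every t ≥ 1: g_t is a subgradient of f_t at x_t on X; ∇Φ(w_{t+1}) = ∇Φ(x_t) − η_t g_t; y_{t+1} ∈ X ∩ D satisfies D_Φ(y_{t+1}, w_{t+1}) ≤ D_Φ(x, w_{t+1}) for all x ∈ X; and x_{t+1} = γ_t y_{t+1} + (1−γ_t) x_1. Then for every T ≥ 1 and every z ∈ X: Σ_{t=1}^T (f_t(x_t) − f_t(z)) ≤ Σ_{t=1}^T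 (D_Φ(x_t, w_{t+1}) − D_Φ(y_{t+1}, w_{t+1}))/η_t + D_Φ(z, x_1)/η_{T+1}. -/
/-! Regret bound for primal-stabilized OMD (Theorem 2). -/

open scoped RealInnerProductSpace BigOperators

open Filter Topology in
theorem grad_tendsto {n : ℕ} {Φ : EuclideanSpace ℝ (Fin n) → ℝ} {G y : EuclideanSpace ℝ (Fin n)}
    (h : HasGradientAt Φ G y) (v : EuclideanSpace ℝ (Fin n)) :
    Tendsto (fun s : ℝ => s⁻¹ * (Φ (y + s • v) - Φ y)) (𝓝[>] 0) (𝓝 ⟪G, v⟫) := by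
  have h1 := (h.hasFDerivAt.hasLineDerivAt v).tendsto_slope_zero_right
  simpa using h1

theorem grad_le {n : ℕ} {Φ : EuclideanSpace ℝ (Fin n) → ℝ} {G y v : EuclideanSpace ℝ (Fin n)}
    {c : ℝ} (h : HasGradientAt Φ G y)
    (hc : ∀ s : ℝ, 0 < s → s < 1 → Φ (y + s • v) - Φ y ≤ s * c) : ⟪G, v⟫ ≤ c := by
  refine le_of_tendsto (grad_tendsto h v) ?_
  filter_upwards [Ioo_mem_nhdsGT (zero_lt_one (α := ℝ))] with s hs
  rw [inv_mul_le_iff₀ hs.1]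
  exact hc s hs.1 hs.2

theorem grad_ge {n : ℕ} {Φ : EuclideanSpace ℝ (Fin n) → ℝ} {G y v : EuclideanSpace ℝ (Fin n)}
    {c : ℝ} (h : HasGradientAt Φ G y)
    (hc : ∀ s : ℝ, 0 < s → s < 1 → s * c ≤ Φ (y + s • v) - Φ y) : c ≤ ⟪G, v⟫ := by
  refine ge_of_tendsto (grad_tendsto h v) ?_
  filter_upwards [Ioo_mem_nhdsGT (zero_lt_one (α := ℝ))] with s hs
  rw [le_inv_mul_iff₀ hs.1]
  exact hc s hs.1 hs.2

theorem ps_omd_regret_bound {n : ℕ}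
    (D X : Set (EuclideanSpace ℝ (Fin n)))
    (Φ : EuclideanSpace ℝ (Fin n) → ℝ)
    (Φ' : EuclideanSpace ℝ (Fin n) → EuclideanSpace ℝ (Fin n))
    -- mirror map setup
    (hDopen : IsOpen D) (hDconv : Convex ℝ D) (hDne : D.Nonempty)
    (hΦconv : ConvexOn ℝ (closure D) Φ)
    (hΦstrict : StrictConvexOn ℝ D Φ)
    (hΦgrad : ∀ y ∈ D, HasGradientAt Φ (Φ' y) y)
    (hΦbij : Set.BijOn Φ' D Set.univ)
    (hXclosed : IsClosed X) (hXconv : Convex ℝ X)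
    (hXsub : X ⊆ closure D) (hXDne : (X ∩ D).Nonempty)
    -- convexity of the Bregman divergence in its second argument
    (hDconvex2 : ∀ z ∈ X, ConvexOn ℝ (X ∩ D) (fun y => bregman Φ Φ' z y))
    -- learning rates and stabilization parameters
    (η : ℕ → ℝ) (hη : ∀ t, 0 < η t) (hηmono : ∀ t, η (t + 1) ≤ η t)
    (γ : ℕ → ℝ) (hγ : ∀ t, γ t = η (t + 1) / η t)
    -- cost functions
    (f : ℕ → EuclideanSpace ℝ (Fin n) → ℝ)
    (hfconv : ∀ t, 1 ≤ t → ConvexOn ℝ X (f t))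
    -- iterates of primal-stabilized OMD
    (x w y g : ℕ → EuclideanSpace ℝ (Fin n))
    (hx : ∀ t, 1 ≤ t → x t ∈ X ∩ D)
    (hw : ∀ t, 2 ≤ t → w t ∈ D)
    (hy : ∀ t, 2 ≤ t → y t ∈ X ∩ D)
    (hsubgrad : ∀ t, 1 ≤ t → ∀ z ∈ X, f t (x t) + ⟪g t, z - x t⟫ ≤ f t z)
    (hwstep : ∀ t, 1 ≤ t → Φ' (w (t + 1)) = Φ' (x t) - η t • g t)
    (hproj : ∀ t, 1 ≤ t → ∀ u ∈ X,
      bregman Φ Φ' (y (t + 1)) (w (t + 1)) ≤ bregman Φ Φ' u (w (t + 1)))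
    (hxstep : ∀ t, 1 ≤ t → x (t + 1) = γ t • y (t + 1) + (1 - γ t) • x 1) :
    ∀ T, 1 ≤ T → ∀ z ∈ X,
      ∑ t ∈ Finset.Icc 1 T, (f t (x t) - f t z) ≤
        ∑ t ∈ Finset.Icc 1 T,
          (bregman Φ Φ' (x t) (w (t + 1)) - bregman Φ Φ' (y (t + 1)) (w (t + 1))) / η t
        + bregman Φ Φ' z (x 1) / η (T + 1) := by
  intro T hT z hz
  have hnn : ∀ u ∈ X ∩ D, 0 ≤ bregman Φ Φ' z u := by
    intro u hu
    have h : ⟪Φ' u, z - u⟫ ≤ Φ z - Φ u := by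
      refine grad_le (hΦgrad u hu.2) ?_
      intro s h0 h1
      have h2 := hΦconv.2 (hXsub hu.1) (hXsub hz) (by linarith : 0 ≤ 1 - s) h0.le (by ring)
      have e : (1 - s) • u + s • z = u + s • (z - u) := by module
      rw [e] at h2
      simp only [smul_eq_mul] at h2
      linarith
    unfold bregman
    linarith
  have hpyth : ∀ t, 1 ≤ t → bregman Φ Φ' z (y (t + 1)) +
      bregman Φ Φ' (y (t + 1)) (w (t + 1)) ≤ bregman Φ Φ' z (w (t + 1)) := by
    intro t ht
    have hyt := hy (t + 1) (by omega)
    have h : ⟪Φ' (w (t + 1)), z - y (t + 1)⟫ ≤ ⟪Φ' (y (t + 1)), z - y (t + 1)⟫ := by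
      refine grad_ge (hΦgrad _ hyt.2) ?_
      intro s h0 h1
      have hu : y (t + 1) + s • (z - y (t + 1)) ∈ X :=
        hXconv.add_smul_sub_mem hyt.1 hz ⟨h0.le, h1.le⟩
      have h2 := hproj t ht _ hu
      unfold bregman at h2
      simp only [inner_sub_right, inner_add_right, inner_smul_right] at h2 ⊢
      linarith
    unfold bregman
    simp only [inner_sub_right] at h ⊢
    linarith
  have hstep : ∀ t, 1 ≤ t → f t (x t) - f t z ≤
      (bregman Φ Φ' (x t) (w (t + 1)) - bregman Φ Φ' (y (t + 1)) (w (t + 1))) / η t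
      + bregman Φ Φ' z (x t) / η t - bregman Φ Φ' z (x (t + 1)) / η (t + 1)
      + (1 / η (t + 1) - 1 / η t) * bregman Φ Φ' z (x 1) := by
    intro t ht
    have p := hη t
    have p1 := hη (t + 1)
    have h1 := hsubgrad t ht z hz
    have h2 := hpyth t ht
    have h3 : η t * ⟪g t, x t - z⟫ = bregman Φ Φ' (x t) (w (t + 1))
        - bregman Φ Φ' z (w (t + 1)) + bregman Φ Φ' z (x t) := by
      unfold bregman
      rw [hwstep t ht]
      simp only [inner_sub_right, inner_sub_left, real_inner_smul_left]
      ring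
    have hg0 : 0 ≤ γ t := by rw [hγ]; positivity
    have hg1 : γ t ≤ 1 := by rw [hγ, div_le_one p]; exact hηmono t
    have h4 := (hDconvex2 z hz).2 (hy (t + 1) (by omega)) (hx 1 le_rfl) hg0
      (by linarith : 0 ≤ 1 - γ t) (by ring)
    simp only [smul_eq_mul] at h4
    rw [← hxstep t ht, hγ] at h4
    have h5 : ⟪g t, x t - z⟫ = - ⟪g t, z - x t⟫ := by
      simp only [inner_sub_right]; ring
    generalize bregman Φ Φ' z (x (t + 1)) = A at *
    generalize bregman Φ Φ' z (y (t + 1)) = B at *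
    generalize bregman Φ Φ' z (x 1) = C at *
    generalize bregman Φ Φ' z (x t) = E at *
    generalize bregman Φ Φ' z (w (t + 1)) = F at *
    generalize bregman Φ Φ' (x t) (w (t + 1)) = P at *
    generalize bregman Φ Φ' (y (t + 1)) (w (t + 1)) = Q at *
    have h6 : ⟪g t, x t - z⟫ ≤ (P - Q) / η t + E / η t - B / η t := by
      rw [← add_div, ← sub_div, le_div_iff₀ p]
      linarith
    have h7 : A / η (t + 1) ≤ B / η t + (1 / η (t + 1) - 1 / η t) * C := by
      rw [div_le_iff₀ p1]
      refine h4.trans (le_of_eq ?_)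
      field_simp
    linarith
  have key : ∀ T, ∑ t ∈ Finset.Icc 1 T, (f t (x t) - f t z) ≤
        ∑ t ∈ Finset.Icc 1 T,
          (bregman Φ Φ' (x t) (w (t + 1)) - bregman Φ Φ' (y (t + 1)) (w (t + 1))) / η t
        + bregman Φ Φ' z (x 1) / η (T + 1) - bregman Φ Φ' z (x (T + 1)) / η (T + 1) := by
    intro T
    induction T with
    | zero => simp
    | succ k ih =>
      rw [Finset.sum_Icc_succ_top (by omega), Finset.sum_Icc_succ_top (by omega)]
      have h := hstep (k + 1) (by omega)
      rw [sub_mul, one_div_mul_eq_div, one_div_mul_eq_div] at h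
      linarith
  have h1 := key T
  have h2 : 0 ≤ bregman Φ Φ' z (x (T + 1)) / η (T + 1) :=
    div_nonneg (hnn _ (hx _ (by omega))) (hη _).le
  linarith
end

section
/- Per-round inequality for primal-stabilized OMD (Claim 2). Let η_t, η_{t+1} > 0 with η_{t+1} ≤ η_t and γ_t := η_{t+1}/η_t ∈ (0,1]. Assume that for every z ∈ X the map y ↦ D_Φ(z, y) is convex on X ∩ D. Let x_t, x_1 ∈ X ∩ D, w_{t+1} ∈ D, let y_{t+1} ∈ X ∩ D satisfy D_Φ(y_{t+1}, w_{t+1}) ≤ D_Φ(x, w_{t+1}) for all x ∈ X, and set x_{t+1} := γ_t y_{t+1} + (1−γ_t) x_1. Then for every z ∈ X: (1/η_t)·(D_Φ(x_t, w_{t+1}) − D_Φ(z, w_{t+1}) + D_Φ(z, x_t)) ≤ (D_Φ(x_t, w_{t+1}) − D_Φ(y_{t+1}, w_{t+1}))/η_t + (1/η_{t+1} − 1/η_t)·D_Φ(z, x_1) + D_Φ(z, x_t)/η_t − D_Φ(z, x_{t+1})/η_{t+1}. -/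
/-! Per-round inequality for primal-stabilized OMD (Claim 2). -/

open scoped RealInnerProductSpace BigOperators

theorem ps_omd_per_round {n : ℕ}
    (D X : Set (EuclideanSpace ℝ (Fin n)))
    (Φ : EuclideanSpace ℝ (Fin n) → ℝ)
    (Φ' : EuclideanSpace ℝ (Fin n) → EuclideanSpace ℝ (Fin n))
    -- mirror map setup
    (hDopen : IsOpen D) (hDconv : Convex ℝ D) (hDne : D.Nonempty)
    (hΦconv : ConvexOn ℝ (closure D) Φ)
    (hΦstrict : StrictConvexOn ℝ D Φ)
    (hΦgrad : ∀ y ∈ D, HasGradientAt Φ (Φ' y) y)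
    (hΦbij : Set.BijOn Φ' D Set.univ)
    (hXclosed : IsClosed X) (hXconv : Convex ℝ X)
    (hXsub : X ⊆ closure D) (hXDne : (X ∩ D).Nonempty)
    -- convexity of the Bregman divergence in its second argument
    (hDconvex2 : ∀ z ∈ X, ConvexOn ℝ (X ∩ D) (fun y => bregman Φ Φ' z y))
    -- learning rates
    (ηt ηt1 : ℝ) (hηt : 0 < ηt) (hηt1 : 0 < ηt1) (hmono : ηt1 ≤ ηt)
    (γt : ℝ) (hγt : γt = ηt1 / ηt)
    -- iterates
    (x1 xt : EuclideanSpace ℝ (Fin n)) (wnext ynext : EuclideanSpace ℝ (Fin n))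
    (hx1 : x1 ∈ X ∩ D) (hxt : xt ∈ X ∩ D)
    (hwnext : wnext ∈ D) (hynext : ynext ∈ X ∩ D)
    (hproj : ∀ u ∈ X, bregman Φ Φ' ynext wnext ≤ bregman Φ Φ' u wnext)
    (xnext : EuclideanSpace ℝ (Fin n))
    (hxnext : xnext = γt • ynext + (1 - γt) • x1) :
    ∀ z ∈ X,
      (1 / ηt) * (bregman Φ Φ' xt wnext - bregman Φ Φ' z wnext + bregman Φ Φ' z xt) ≤
        (bregman Φ Φ' xt wnext - bregman Φ Φ' ynext wnext) / ηt
        + (1 / ηt1 - 1 / ηt) * bregman Φ Φ' z x1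
        + bregman Φ Φ' z xt / ηt - bregman Φ Φ' z xnext / ηt1 := by
  intro z hz
  have key : 0 ≤ ⟪Φ' ynext - Φ' wnext, z - ynext⟫ := by
    have hmin : IsLocalMinOn (fun u => Φ u - ⟪Φ' wnext, u⟫) X ynext := by
      apply IsMinOn.localize
      intro u hu
      have := hproj u hu
      simp only [bregman, inner_sub_right] at this
      simp only [Set.mem_setOf_eq]
      linarith
    have hd := ((hΦgrad ynext hynext.2).hasFDerivAt.sub
      (innerSL ℝ (Φ' wnext)).hasFDerivAt).hasFDerivWithinAt (s := X)
    have h := hmin.hasFDerivWithinAt_nonneg hd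
      (sub_mem_posTangentConeAt_of_segment_subset (hXconv.segment_subset hynext.1 hz))
    simpa [inner_sub_left] using h
  have h1 : bregman Φ Φ' z ynext ≤ bregman Φ Φ' z wnext - bregman Φ Φ' ynext wnext := by
    simp only [bregman, inner_sub_right, inner_sub_left] at key ⊢
    linarith
  have hg0 : 0 ≤ γt := by rw [hγt]; positivity
  have hg1 : γt ≤ 1 := by rw [hγt]; exact (div_le_one hηt).2 hmono
  have h2 := (hDconvex2 z hz).2 hynext hx1 hg0 (sub_nonneg.2 hg1) (by ring)
  rw [← hxnext] at h2
  simp only [smul_eq_mul] at h2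
  have h3 := div_le_div_of_nonneg_right h2 hηt1.le
  have h4 : (γt * bregman Φ Φ' z ynext + (1 - γt) * bregman Φ Φ' z x1) / ηt1
      = bregman Φ Φ' z ynext / ηt + (1 / ηt1 - 1 / ηt) * bregman Φ Φ' z x1 := by
    rw [hγt]; field_simp
  rw [h4] at h3
  have h5 := div_le_div_of_nonneg_right h1 hηt.le
  have h6 : (1 / ηt) * (bregman Φ Φ' xt wnext - bregman Φ Φ' z wnext + bregman Φ Φ' z xt)
      = (bregman Φ Φ' xt wnext - bregman Φ Φ' ynext wnext) / ηt + bregman Φ Φ' z xt / ηt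
        - (bregman Φ Φ' z wnext - bregman Φ Φ' ynext wnext) / ηt := by ring
  rw [h6]
  linarith
end

section
/- Lazy gradient step recovers dual averaging (Claim 3). Let η : ℕ → ℝ_{>0} be nonincreasing with γ_t := η_{t+1}/η_t, let x̂_1 ∈ ℝⁿ and let {g_t}_{t≥1} ⊆ ℝⁿ. Define sequences {ŷ_t}_{t≥1} and {ŵ_t}_{t≥2} in ℝⁿ by ŷ_1 := x̂_1 and, for t ≥ 1, ŵ_{t+1} := ŷ_t − η_t g_t and ŷ_{t+1} := γ_t ŵ_{t+1} + (1−γ_t) x̂_1. Then for every t > 1: ŵ_t = x̂_1 − η_{t−1} Σ_{i<t} g_i and ŷ_t = x̂_1 − η_t Σ_{i<t} g_i. -/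
/-! Lazy gradient step recovers dual averaging (Claim 3). -/

open scoped BigOperators

theorem lazy_step_is_dual_averaging {n : ℕ}
    (η : ℕ → ℝ) (hη : ∀ t, 0 < η t) (hηmono : ∀ t, η (t + 1) ≤ η t)
    (γ : ℕ → ℝ) (hγ : ∀ t, γ t = η (t + 1) / η t)
    (xhat1 : EuclideanSpace ℝ (Fin n))
    (g yhat what : ℕ → EuclideanSpace ℝ (Fin n))
    (hy1 : yhat 1 = xhat1)
    (hwstep : ∀ t, 1 ≤ t → what (t + 1) = yhat t - η t • g t)
    (hystep : ∀ t, 1 ≤ t → yhat (t + 1) = γ t • what (t + 1) + (1 - γ t) • xhat1) :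
    ∀ t, 1 < t →
      what t = xhat1 - η (t - 1) • ∑ i ∈ Finset.Ico 1 t, g i ∧
      yhat t = xhat1 - η t • ∑ i ∈ Finset.Ico 1 t, g i := by
  have hw : ∀ t, 1 ≤ t → yhat t = xhat1 - η t • ∑ i ∈ Finset.Ico 1 t, g i →
      what (t + 1) = xhat1 - η t • ∑ i ∈ Finset.Ico 1 (t + 1), g i := by
    intro t ht h
    rw [hwstep t ht, h, Finset.sum_Ico_succ_top ht, smul_add]
    abel
  have hy : ∀ t, 1 ≤ t → yhat t = xhat1 - η t • ∑ i ∈ Finset.Ico 1 t, g i := by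
    intro t ht
    induction t, ht using Nat.le_induction with
    | base => simp [hy1]
    | succ t ht ih =>
      have e : γ t * η t = η (t + 1) := by
        rw [hγ, div_mul_cancel₀ _ (hη t).ne']
      rw [hystep t ht, hw t ht ih, ← e]
      module
  intro t ht
  obtain ⟨s, rfl⟩ : ∃ s, t = s + 1 := ⟨t - 1, by omega⟩
  have hs : 1 ≤ s := by omega
  exact ⟨by simpa using hw s hs (hy s hs), hy _ (by omega)⟩
end

section
/- KL-divergence difference is bounded by Λ (Proposition 2). For every a, b in the probability simplex Δ_n and every c ∈ ℝ_{>0}ⁿ: D_KL(a, c) − D_KL(b, c) ≤ Λ(a, c). -/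
/-! KL-divergence difference is bounded by Λ (Proposition 2). -/

open scoped BigOperators

/-- Generalized KL-divergence `D_KL(a,b) = Σ_i a_i ln(a_i/b_i) − Σ_i a_i + Σ_i b_i`
(with the convention `0 · ln 0 = 0`, automatic since `Real.log 0 = 0`). -/
noncomputable def genKL {n : ℕ} (a b : Fin n → ℝ) : ℝ :=
  ∑ i, a i * Real.log (a i / b i) - ∑ i, a i + ∑ i, b i

/-- `Λ(a,b) = Σ_i a_i ln(a_i/b_i) + ln(Σ_i b_i)`. -/
noncomputable def Lam {n : ℕ} (a b : Fin n → ℝ) : ℝ :=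
  ∑ i, a i * Real.log (a i / b i) + Real.log (∑ i, b i)

theorem kl_diff_le_Lam {n : ℕ} (a b c : Fin n → ℝ)
    (ha : a ∈ stdSimplex ℝ (Fin n)) (hb : b ∈ stdSimplex ℝ (Fin n))
    (hc : ∀ i, 0 < c i) :
    genKL a c - genKL b c ≤ Lam a c := by
  have hn : Nonempty (Fin n) := by
    by_contra h
    have : IsEmpty (Fin n) := not_nonempty_iff.mp h
    have h1 := hb.2
    simp at h1
  have hS : 0 < ∑ i, c i := Finset.sum_pos (fun i _ => hc i) Finset.univ_nonempty
  have key : ∀ i, b i - c i / (∑ j, c j)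
      ≤ b i * Real.log (b i / c i) + b i * Real.log (∑ j, c j) := by
    intro i
    generalize (∑ j, c j) = S at hS
    have hci := hc i
    rcases (hb.1 i).eq_or_lt with h | h
    · rw [← h]
      have : 0 < c i / S := by positivity
      simp only [zero_mul]
      linarith
    · have h1 := Real.log_le_sub_one_of_pos (show 0 < c i / (S * b i) by positivity)
      rw [Real.log_div hci.ne' (by positivity), Real.log_mul hS.ne' h.ne'] at h1
      rw [Real.log_div h.ne' hci.ne']
      have h2 := mul_le_mul_of_nonneg_left h1 h.le
      have h3 : b i * (c i / (S * b i) - 1) = c i / S - b i := by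
        field_simp
      linarith
  have hsum := Finset.sum_le_sum (fun i (_ : i ∈ Finset.univ) => key i)
  rw [Finset.sum_sub_distrib, Finset.sum_add_distrib, ← Finset.sum_div, ← Finset.sum_mul,
    div_self hS.ne', hb.2] at hsum
  unfold genKL Lam
  rw [ha.2, hb.2]
  linarith
end

section
/- Regret bound for dual averaging in the experts setting (Corollary 2, DA case). Let n ≥ 2, let η : ℕ → ℝ_{>0} be nonincreasing, and let {f_t}_{t≥1} be convex functions f_t : Δ_n → ℝ. Define sequences {x_t}_{t≥1} ⊆ Δ_n and {g_t}_{t≥1} ⊆ ℝⁿ recursively by: x_1 := (1/n, …, 1/n); g_t satisfies f_t(z) ≥ f_t(x_t) + ⟨g_t, z − x_t⟩ for all z ∈ Δ_n; and x_{t+1}(i) := exp(−η_{t+1} Σ_{s=1}^t g_s(i)) / Σ_{j=1}^n exp(−η_{t+1} Σ_{s=1}^t g_s(j)) for each coordinate i. Then for every T ≥ 1 and every z ∈ Δ_n: Σ_{t=1}^T (f_t(x_t) − f_t(z)) ≤ Σ_{t=1}^T Λ(x_t, c_t)/η_t + ln(n)/η_{T+1}, where c_t ∈ ℝ_{>0}ⁿ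 is defined by c_t(i) := x_t(i)·exp(−η_t g_t(i)). -/
/-! Regret bound for dual averaging in the experts setting (Corollary 2, DA case). -/

open scoped BigOperators

/-- normalized log-partition function -/
noncomputable def PP {n : ℕ} (a : ℝ) (G : Fin n → ℝ) : ℝ :=
  Real.log (∑ i, (1 / (n : ℝ)) * Real.exp (-a * G i)) / a

theorem PP_mono {n : ℕ} (hn : 0 < n) (a b : ℝ) (hb : 0 < b) (hab : b ≤ a) (G : Fin n → ℝ) :
    PP b G ≤ PP a G := by
  have ha : 0 < a := hb.trans_le hab
  have hn' : (0 : ℝ) < n := by exact_mod_cast hn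
  have : Nonempty (Fin n) := ⟨⟨0, hn⟩⟩
  have h := Real.rpow_arith_mean_le_arith_mean_rpow (Finset.univ : Finset (Fin n))
    (fun _ => 1 / (n : ℝ)) (fun i => Real.exp (-b * G i)) (fun i _ => by positivity)
    (by simp [hn'.ne']) (fun i _ => (Real.exp_pos _).le) (p := a / b)
    ((one_le_div hb).2 hab)
  have hpos : ∀ c : ℝ, 0 < ∑ i : Fin n, (1 / (n : ℝ)) * Real.exp (-c * G i) := fun c =>
    Finset.sum_pos (fun i _ => by positivity) Finset.univ_nonempty
  have e : ∀ i, Real.exp (-b * G i) ^ (a / b) = Real.exp (-a * G i) := by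
    intro i
    rw [← Real.exp_mul]
    congr 1
    field_simp
  simp only [e] at h
  have h2 := Real.log_le_log (Real.rpow_pos_of_pos (hpos b) _) h
  rw [Real.log_rpow (hpos b)] at h2
  unfold PP
  rw [div_le_div_iff₀ hb ha]
  rw [div_mul_eq_mul_div, div_le_iff₀ hb] at h2
  linarith

theorem Lam_eq {n : ℕ} (hn : 0 < n) (a : ℝ) (ha : 0 < a) (G d y : Fin n → ℝ)
    (hy : ∀ i, y i = Real.exp (-a * G i) / ∑ j, Real.exp (-a * G j)) :
    Lam y (fun i => y i * Real.exp (-a * d i)) / a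
      = ∑ i, d i * y i + PP a (fun i => G i + d i) - PP a G := by
  have hn' : (0 : ℝ) < n := by exact_mod_cast hn
  have : Nonempty (Fin n) := ⟨⟨0, hn⟩⟩
  have hpos : ∀ F : Fin n → ℝ, 0 < ∑ i : Fin n, Real.exp (-a * F i) := fun c =>
    Finset.sum_pos (fun i _ => by positivity) Finset.univ_nonempty
  have hypos : ∀ i, 0 < y i := fun i => by
    rw [hy]; exact div_pos (Real.exp_pos _) (hpos G)
  have h1 : ∀ i, y i * Real.log (y i / (y i * Real.exp (-a * d i))) = a * (d i * y i) := by
    intro i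
    rw [div_mul_cancel_left₀ (hypos i).ne', ← Real.exp_neg, Real.log_exp]
    ring
  have h2 : ∑ i, y i * Real.exp (-a * d i)
      = (∑ i, Real.exp (-a * (G i + d i))) / ∑ j, Real.exp (-a * G j) := by
    rw [Finset.sum_div]
    refine Finset.sum_congr rfl fun i _ => ?_
    rw [hy, mul_add, Real.exp_add]
    ring
  have h3 := (hpos G).ne'
  have h4 := (hpos (fun i => G i + d i)).ne'
  have h5 : (1 / (n : ℝ)) ≠ 0 := by positivity
  unfold Lam PP
  simp only [h1, h2, ← Finset.mul_sum]
  rw [Real.log_div h4 h3, Real.log_mul h5 h4, Real.log_mul h5 h3]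
  field_simp
  ring

theorem PP_lower {n : ℕ} (hn : 0 < n) (a : ℝ) (ha : 0 < a) (G z : Fin n → ℝ)
    (hz : z ∈ stdSimplex ℝ (Fin n)) :
    -∑ i, G i * z i ≤ PP a G + Real.log n / a := by
  have hn' : (0 : ℝ) < n := by exact_mod_cast hn
  have : Nonempty (Fin n) := ⟨⟨0, hn⟩⟩
  have hpos : 0 < ∑ i : Fin n, Real.exp (-a * G i) :=
    Finset.sum_pos (fun i _ => by positivity) Finset.univ_nonempty
  have h1 : ∀ i, -a * G i ≤ Real.log (∑ i : Fin n, Real.exp (-a * G i)) := fun i => by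
    rw [Real.le_log_iff_exp_le hpos]
    exact Finset.single_le_sum (f := fun i => Real.exp (-a * G i))
      (fun i _ => (Real.exp_pos _).le) (Finset.mem_univ i)
  have h2 : ∑ i, (-a * G i) * z i ≤ ∑ i, Real.log (∑ i : Fin n, Real.exp (-a * G i)) * z i :=
    Finset.sum_le_sum fun i _ => mul_le_mul_of_nonneg_right (h1 i) (hz.1 i)
  rw [← Finset.mul_sum, hz.2, mul_one] at h2
  have h3 : ∑ i, (-a * G i) * z i = -(∑ i, G i * z i) * a := by
    rw [← Finset.sum_neg_distrib, Finset.sum_mul]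
    exact Finset.sum_congr rfl fun i _ => by ring
  unfold PP
  rw [← Finset.mul_sum, Real.log_mul (by positivity) hpos.ne', ← add_div, le_div_iff₀ ha, ← h3,
    one_div, Real.log_inv]
  linarith

theorem da_experts_regret_bound {n : ℕ} (hn : 2 ≤ n)
    (η : ℕ → ℝ) (hη : ∀ t, 0 < η t) (hηmono : ∀ t, η (t + 1) ≤ η t)
    (f : ℕ → (Fin n → ℝ) → ℝ)
    (hfconv : ∀ t, 1 ≤ t → ConvexOn ℝ (stdSimplex ℝ (Fin n)) (f t))
    (x g : ℕ → Fin n → ℝ)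
    (hx1 : x 1 = fun _ => (1 : ℝ) / n)
    (hsubgrad : ∀ t, 1 ≤ t → ∀ z ∈ stdSimplex ℝ (Fin n),
      f t (x t) + ∑ i, g t i * (z i - x t i) ≤ f t z)
    (hxstep : ∀ t, 1 ≤ t → ∀ i, x (t + 1) i =
      Real.exp (-(η (t + 1)) * ∑ s ∈ Finset.Icc 1 t, g s i) /
        ∑ j, Real.exp (-(η (t + 1)) * ∑ s ∈ Finset.Icc 1 t, g s j)) :
    ∀ T, 1 ≤ T → ∀ z ∈ stdSimplex ℝ (Fin n),
      ∑ t ∈ Finset.Icc 1 T, (f t (x t) - f t z) ≤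
        ∑ t ∈ Finset.Icc 1 T,
          Lam (x t) (fun i => x t i * Real.exp (-(η t) * g t i)) / η t
        + Real.log n / η (T + 1) := by
  have hn0 : 0 < n := by omega
  have hn' : (0 : ℝ) < n := by exact_mod_cast hn0
  have hx : ∀ t i, x (t + 1) i =
      Real.exp (-(η (t + 1)) * ∑ s ∈ Finset.Icc 1 t, g s i) /
        ∑ j, Real.exp (-(η (t + 1)) * ∑ s ∈ Finset.Icc 1 t, g s j) := by
    intro t i
    rcases Nat.eq_zero_or_pos t with rfl | ht
    · simp [hx1]
    · exact hxstep t ht i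
  have key : ∀ T, ∑ t ∈ Finset.Icc 1 T, ∑ i, g t i * x t i
        + PP (η (T + 1)) (fun i => ∑ s ∈ Finset.Icc 1 T, g s i) ≤
      ∑ t ∈ Finset.Icc 1 T, Lam (x t) (fun i => x t i * Real.exp (-(η t) * g t i)) / η t := by
    intro T
    induction T with
    | zero => simp [PP, hn'.ne']
    | succ T ih =>
      rw [Finset.sum_Icc_succ_top (by omega), Finset.sum_Icc_succ_top (by omega),
        Lam_eq hn0 (η (T + 1)) (hη _) (fun i => ∑ s ∈ Finset.Icc 1 T, g s i) (g (T + 1))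
          (x (T + 1)) (hx T)]
      have e : (fun i => ∑ s ∈ Finset.Icc 1 (T + 1), g s i)
          = fun i => ∑ s ∈ Finset.Icc 1 T, g s i + g (T + 1) i := by
        funext i
        rw [Finset.sum_Icc_succ_top (by omega)]
      rw [e]
      have hm := PP_mono hn0 (η (T + 1)) (η (T + 1 + 1)) (hη _) (hηmono _)
        (fun i => ∑ s ∈ Finset.Icc 1 T, g s i + g (T + 1) i)
      linarith
  intro T hT z hz
  have h1 : ∑ t ∈ Finset.Icc 1 T, (f t (x t) - f t z) ≤
      ∑ t ∈ Finset.Icc 1 T, (∑ i, g t i * x t i - ∑ i, g t i * z i) := by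
    refine Finset.sum_le_sum fun t ht => ?_
    have := hsubgrad t (Finset.mem_Icc.1 ht).1 z hz
    simp only [mul_sub, Finset.sum_sub_distrib] at this
    linarith
  rw [Finset.sum_sub_distrib (f := fun t => ∑ i, g t i * x t i)] at h1
  have h2 := PP_lower hn0 (η (T + 1)) (hη _) (fun i => ∑ s ∈ Finset.Icc 1 T, g s i) z hz
  have h3 : ∑ i, (∑ s ∈ Finset.Icc 1 T, g s i) * z i
      = ∑ t ∈ Finset.Icc 1 T, ∑ i, g t i * z i := by
    simp only [Finset.sum_mul]
    exact Finset.sum_comm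
  simp only [h3] at h2
  have := key T
  linarith
end

section
/- Anytime regret bound for prediction with expert advice (Corollary 3). Let n ≥ 2 and set η_t := 2√(ln(n)/t) for t ≥ 1. Let {g_t}_{t≥1} ⊆ [0,1]ⁿ be an arbitrary sequence of cost vectors, defining linear losses f_t(x) := ⟨g_t, x⟩ on Δ_n. Define x_t ∈ Δ_n by x_t(i) := exp(−η_t Σ_{s<t} g_s(i)) / Σ_{j=1}^n exp(−η_t Σ_{s<t} g_s(j)) (so x_1 is the uniform distribution). Then for every T ≥ 1 and every z ∈ Δ_n: Σ_{t=1}^T ⟨g_t, x_t⟩ − Σ_{t=1}^T ⟨g_t, z⟩ ≤ √(T ln n). -/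
/-! Anytime regret bound for prediction with expert advice (Corollary 3). -/

open scoped BigOperators

lemma aux_hoeffding {n : ℕ} (p : Fin n → ℝ) (hp : ∀ i, 0 ≤ p i) (hs : ∑ i, p i = 1)
    (g : Fin n → ℝ) (hg : ∀ i, g i ∈ Set.Icc (0 : ℝ) 1) (e : ℝ) :
    ∑ i, p i * Real.exp (-e * g i) ≤ Real.exp (-e * (∑ i, g i * p i) + e ^ 2 / 8) := by
  let P : PMF (Fin n) := PMF.ofFintype (fun i => ENNReal.ofReal (p i)) (by
    rw [← ENNReal.ofReal_sum_of_nonneg (fun i _ => hp i), hs, ENNReal.ofReal_one])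
  have hP : ∀ i, (P i).toReal = p i := fun i => by
    simp [P, ENNReal.toReal_ofReal (hp i)]
  have h := ProbabilityTheory.hasSubgaussianMGF_of_mem_Icc (μ := P.toMeasure) (X := g)
    (a := 0) (b := 1) (measurable_of_finite g).aemeasurable (Filter.Eventually.of_forall hg)
  have h2 := h.mgf_le (-e)
  unfold ProbabilityTheory.mgf at h2
  rw [PMF.integral_eq_sum, PMF.integral_eq_sum] at h2
  simp only [hP, smul_eq_mul] at h2
  have hm : ∑ i, p i * g i = ∑ i, g i * p i := Finset.sum_congr rfl fun i _ => mul_comm _ _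
  rw [hm] at h2
  set m := ∑ i, g i * p i
  have h3 : ∑ i, p i * Real.exp (-e * g i) =
      Real.exp (-e * m) * ∑ i, p i * Real.exp (-e * (g i - m)) := by
    rw [Finset.mul_sum]
    refine Finset.sum_congr rfl fun i _ => ?_
    rw [mul_left_comm, ← Real.exp_add]
    congr 2; ring
  rw [h3, Real.exp_add]
  refine mul_le_mul_of_nonneg_left (h2.trans ?_) (Real.exp_pos _).le
  apply Real.exp_le_exp.2
  apply le_of_eq
  norm_num
  ring

lemma aux_mono {n : ℕ} (hn : 2 ≤ n) (L : Fin n → ℝ) {a b : ℝ} (ha : 0 < a) (hab : a ≤ b) :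
    Real.log ((∑ i, Real.exp (-a * L i)) / n) / a ≤
      Real.log ((∑ i, Real.exp (-b * L i)) / n) / b := by
  have hn0 : (0 : ℝ) < n := by positivity
  have : Nonempty (Fin n) := ⟨⟨0, by omega⟩⟩
  have hb : 0 < b := ha.trans_le hab
  have hS : ∀ c : ℝ, 0 < (∑ i, Real.exp (-c * L i)) / n := fun c =>
    div_pos (Finset.sum_pos (fun i _ => Real.exp_pos _) Finset.univ_nonempty) hn0
  have h := Real.rpow_arith_mean_le_arith_mean_rpow Finset.univ (fun _ : Fin n => (1 / n : ℝ))
    (fun i => Real.exp (-a * L i)) (fun i _ => by positivity)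
    (by simp [hn0.ne']) (fun i _ => (Real.exp_pos _).le) (p := b / a) ((one_le_div ha).2 hab)
  rw [← Finset.mul_sum, ← Finset.mul_sum, one_div_mul_eq_div, one_div_mul_eq_div] at h
  have h4 : ∀ i, Real.exp (-a * L i) ^ (b / a) = Real.exp (-b * L i) := fun i => by
    rw [← Real.exp_mul]; congr 1; field_simp
  simp only [h4] at h
  have h5 := Real.log_le_log (Real.rpow_pos_of_pos (hS a) _) h
  rw [Real.log_rpow (hS a)] at h5
  rw [le_div_iff₀ hb]
  calc _ = b / a * Real.log ((∑ i, Real.exp (-a * L i)) / n) := by ring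
    _ ≤ _ := h5

theorem anytime_experts_regret {n : ℕ} (hn : 2 ≤ n)
    (η : ℕ → ℝ) (hη : ∀ t, 1 ≤ t → η t = 2 * Real.sqrt (Real.log n / t))
    (g : ℕ → Fin n → ℝ) (hg : ∀ t, 1 ≤ t → ∀ i, g t i ∈ Set.Icc (0 : ℝ) 1)
    (x : ℕ → Fin n → ℝ)
    (hx : ∀ t, 1 ≤ t → ∀ i, x t i =
      Real.exp (-(η t) * ∑ s ∈ Finset.Ico 1 t, g s i) /
        ∑ j, Real.exp (-(η t) * ∑ s ∈ Finset.Ico 1 t, g s j)) :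
    ∀ T, 1 ≤ T → ∀ z ∈ stdSimplex ℝ (Fin n),
      ∑ t ∈ Finset.Icc 1 T, (∑ i, g t i * x t i)
        - ∑ t ∈ Finset.Icc 1 T, (∑ i, g t i * z i)
      ≤ Real.sqrt (T * Real.log n) := by
  have hn0 : (0 : ℝ) < n := by positivity
  have : Nonempty (Fin n) := ⟨⟨0, by omega⟩⟩
  have hl : 0 < Real.log n := Real.log_pos (by exact_mod_cast (by omega : 1 < n))
  have hS : ∀ (c : ℝ) (L : Fin n → ℝ), 0 < ∑ i, Real.exp (-c * L i) := fun c L =>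
    Finset.sum_pos (fun i _ => Real.exp_pos _) Finset.univ_nonempty
  have hηp : ∀ t, 1 ≤ t → 0 < η t := fun t ht => by
    rw [hη t ht]
    have : (0 : ℝ) < t := by exact_mod_cast ht
    positivity
  -- one step
  have step : ∀ t, 1 ≤ t → ∑ i, g t i * x t i ≤
      Real.log ((∑ i, Real.exp (-(η t) * ∑ s ∈ Finset.Ico 1 t, g s i)) / n) / η t
      - Real.log ((∑ i, Real.exp (-(η t) * ∑ s ∈ Finset.Ico 1 (t + 1), g s i)) / n) / η t
      + η t / 8 := by
    intro t ht
    have he := hηp t ht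
    have hA := hS (η t) (fun i => ∑ s ∈ Finset.Ico 1 t, g s i)
    have hB := hS (η t) (fun i => ∑ s ∈ Finset.Ico 1 (t + 1), g s i)
    have h := aux_hoeffding (x t) (fun i => by rw [hx t ht]; positivity)
      (by simp only [hx t ht]; rw [← Finset.sum_div, div_self hA.ne']) (g t) (hg t ht) (η t)
    have e1 : ∑ i, x t i * Real.exp (-(η t) * g t i) =
        (∑ i, Real.exp (-(η t) * ∑ s ∈ Finset.Ico 1 (t + 1), g s i)) /
        ∑ i, Real.exp (-(η t) * ∑ s ∈ Finset.Ico 1 t, g s i) := by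
      rw [Finset.sum_div]
      refine Finset.sum_congr rfl fun i _ => ?_
      rw [hx t ht, div_mul_eq_mul_div, ← Real.exp_add, Finset.sum_Ico_succ_top ht, mul_add]
    rw [e1] at h
    have h5 := Real.log_le_log (div_pos hB hA) h
    rw [Real.log_exp, Real.log_div hB.ne' hA.ne'] at h5
    rw [Real.log_div hB.ne' hn0.ne', Real.log_div hA.ne' hn0.ne', ← sub_div,
      ← sub_le_iff_le_add, le_div_iff₀ he]
    nlinarith
  have hmono : ∀ t, 1 ≤ t → η (t + 1) ≤ η t := fun t ht => by
    rw [hη t ht, hη (t + 1) (by omega)]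
    have : (0 : ℝ) < t := by exact_mod_cast ht
    gcongr
    simp
  have hsq : ∀ t : ℕ, η (t + 1) / 8 ≤
      (Real.sqrt ((t + 1 : ℕ) * Real.log n) - Real.sqrt (t * Real.log n)) / 2 := by
    intro t
    rw [hη (t + 1) (by omega), Real.sqrt_div hl.le, Real.sqrt_mul (by positivity),
      Real.sqrt_mul (by positivity)]
    have h1 : 0 < Real.sqrt ((t + 1 : ℕ) : ℝ) := Real.sqrt_pos.2 (by positivity)
    have h2 : Real.sqrt ((t + 1 : ℕ) : ℝ) ^ 2 = t + 1 := by
      rw [Real.sq_sqrt (by positivity)]; push_cast; rfl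
    have h3 : Real.sqrt (t : ℝ) ^ 2 = t := Real.sq_sqrt (by positivity)
    have h4 : 0 ≤ Real.sqrt (t : ℝ) := Real.sqrt_nonneg _
    have hl' := Real.sqrt_pos.2 hl
    set u := Real.sqrt ((t + 1 : ℕ) : ℝ)
    set v := Real.sqrt (t : ℝ)
    have : 1 / u ≤ 2 * (u - v) := by
      rw [div_le_iff₀ h1]
      nlinarith [sq_nonneg (u - v)]
    calc 2 * (√(Real.log n) / u) / 8 = √(Real.log n) / 4 * (1 / u) := by ring
      _ ≤ √(Real.log n) / 4 * (2 * (u - v)) := by gcongr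
      _ = _ := by ring
  have main : ∀ T, 1 ≤ T → ∑ t ∈ Finset.Icc 1 T, (∑ i, g t i * x t i) ≤
      - (Real.log ((∑ i, Real.exp (-(η T) * ∑ s ∈ Finset.Ico 1 (T + 1), g s i)) / n) / η T)
      + Real.sqrt (T * Real.log n) / 2 := by
    intro T hT
    induction T, hT using Nat.le_induction with
    | base =>
      have h := step 1 le_rfl
      have h2 := hsq 0
      simp [hn0.ne'] at h h2 ⊢
      linarith
    | succ t ht ih =>
      rw [Finset.sum_Icc_succ_top (by omega)]
      have h := step (t + 1) (by omega)
      have h2 := hsq t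
      have h3 := aux_mono hn (fun i => ∑ s ∈ Finset.Ico 1 (t + 1), g s i)
        (hηp (t + 1) (by omega)) (hmono t ht)
      linarith
  intro T hT z hz
  have he := hηp T hT
  have hm := main T hT
  have hT0 : (0 : ℝ) < T := by exact_mod_cast hT
  have hlow : ∀ i, - (Real.log ((∑ i, Real.exp (-(η T) * ∑ s ∈ Finset.Ico 1 (T + 1), g s i)) / n)
      / η T) ≤ ∑ t ∈ Finset.Icc 1 T, g t i + Real.log n / η T := by
    intro i
    have hB := hS (η T) (fun i => ∑ s ∈ Finset.Ico 1 (T + 1), g s i)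
    have h1 : Real.exp (-(η T) * ∑ s ∈ Finset.Ico 1 (T + 1), g s i) ≤
        ∑ i, Real.exp (-(η T) * ∑ s ∈ Finset.Ico 1 (T + 1), g s i) :=
      Finset.single_le_sum (f := fun i => Real.exp (-(η T) * ∑ s ∈ Finset.Ico 1 (T + 1), g s i))
        (fun i _ => (Real.exp_pos _).le) (Finset.mem_univ i)
    have h2 := Real.log_le_log (Real.exp_pos _) h1
    rw [Real.log_exp] at h2
    have h6 : Finset.Icc 1 T = Finset.Ico 1 (T + 1) := by ext; simp only [Finset.mem_Icc, Finset.mem_Ico]; omega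
    rw [Real.log_div hB.ne' hn0.ne', h6, sub_div, neg_sub, sub_eq_add_neg, add_comm]
    gcongr
    rw [← neg_div, div_le_iff₀ he]
    linarith
  have hlast : Real.log n / η T = Real.sqrt (T * Real.log n) / 2 := by
    rw [hη T hT, Real.sqrt_div hl.le, Real.sqrt_mul hT0.le]
    have h1 := Real.sqrt_pos.2 hl
    have h2 := Real.sqrt_pos.2 hT0
    have h3 := Real.sq_sqrt hl.le
    field_simp
    linarith
  have hz2 : ∑ t ∈ Finset.Icc 1 T, (∑ i, g t i * z i)
      = ∑ i, z i * ∑ t ∈ Finset.Icc 1 T, g t i := by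
    rw [Finset.sum_comm]
    refine Finset.sum_congr rfl fun i _ => ?_
    rw [Finset.mul_sum]
    exact Finset.sum_congr rfl fun _ _ => mul_comm _ _
  set Q := - (Real.log ((∑ i, Real.exp (-(η T) * ∑ s ∈ Finset.Ico 1 (T + 1), g s i)) / n) / η T)
  have hfin : Q - Real.log n / η T ≤ ∑ i, z i * ∑ t ∈ Finset.Icc 1 T, g t i := by
    calc Q - Real.log n / η T = ∑ i, z i * (Q - Real.log n / η T) := by
          rw [← Finset.sum_mul, hz.2, one_mul]
      _ ≤ _ := Finset.sum_le_sum fun i _ =>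
          mul_le_mul_of_nonneg_left (by linarith [hlow i]) (hz.1 i)
  rw [hz2]
  linarith
end

section
/- First-order regret bound with self-confident learning rates (Corollary 4). Let n ≥ 2 and let {g_t}_{t≥1} ⊆ [0,1]ⁿ be an arbitrary sequence of cost vectors, defining linear losses f_t(x) := ⟨g_t, x⟩ on Δ_n. Define recursively: A_0 := 0; η_t := √(ln(n)/(1 + A_{t−1})); x_t(i) := exp(−η_t Σ_{s<t} g_s(i)) / Σ_{j=1}^n exp(−η_t Σ_{s<t} g_s(j)) (so x_1 is uniform); and A_t := A_{t−1} + ⟨g_t, x_t⟩. Let L*_T := min_{j∈[n]} Σ_{t=1}^T g_t(j). Then for every T ≥ 1 and every z ∈ Δ_n: Σ_{t=1}^T ⟨g_t, x_t⟩ − Σ_{t=1}^T ⟨g_t, z⟩ ≤ 2√(ln(n)·L*_T) + 8 ln n. -/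
/-! First-order regret bound with self-confident learning rates (Corollary 4). -/

open scoped BigOperators

noncomputable def potF {n : ℕ} (η : ℝ) (G : Fin n → ℝ) : ℝ :=
  -(1 / η) * Real.log (∑ i, (1 / (n : ℝ)) * Real.exp (-η * G i))

lemma potF_zero {n : ℕ} (hn : 2 ≤ n) (η : ℝ) : potF η (fun _ : Fin n => 0) = 0 := by
  have h : (n : ℝ) ≠ 0 := by positivity
  simp [potF, h]

lemma sumexp_pos {n : ℕ} (hn : 2 ≤ n) (G : Fin n → ℝ) (η : ℝ) :
    0 < ∑ i, Real.exp (-η * G i) := by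
  have : Nonempty (Fin n) := ⟨⟨0, by omega⟩⟩
  exact Finset.sum_pos (fun i _ => Real.exp_pos _) Finset.univ_nonempty

lemma potF_anti {n : ℕ} (hn : 2 ≤ n) (G : Fin n → ℝ) {a b : ℝ} (ha : 0 < a) (hab : a ≤ b) :
    potF b G ≤ potF a G := by
  have hn0 : (0 : ℝ) < n := by positivity
  have hb : 0 < b := lt_of_lt_of_le ha hab
  have hp : 1 ≤ b / a := by rwa [one_le_div ha]
  have key := Real.rpow_arith_mean_le_arith_mean_rpow Finset.univ
    (fun _ : Fin n => 1 / (n : ℝ)) (fun i => Real.exp (-a * G i))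
    (fun _ _ => by positivity) (by simp [hn0.ne']) (fun _ _ => (Real.exp_pos _).le) hp
  have e : ∀ i, Real.exp (-a * G i) ^ (b / a) = Real.exp (-b * G i) := by
    intro i
    rw [← Real.exp_mul]
    congr 1
    field_simp
  simp only [e] at key
  have hS : 0 < ∑ i, (1 / (n : ℝ)) * Real.exp (-a * G i) := by
    rw [← Finset.mul_sum]; exact mul_pos (by positivity) (sumexp_pos hn G a)
  have h2 := Real.log_le_log (Real.rpow_pos_of_pos hS _) key
  rw [Real.log_rpow hS] at h2
  unfold potF
  have h3 := mul_le_mul_of_nonneg_left h2 (by positivity : 0 ≤ 1 / b)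
  have h4 : 1 / b * (b / a * Real.log (∑ i, (1 / (n : ℝ)) * Real.exp (-a * G i)))
      = 1 / a * Real.log (∑ i, (1 / (n : ℝ)) * Real.exp (-a * G i)) := by
    field_simp
  linarith

lemma exp_neg_le {y : ℝ} (hy : 0 ≤ y) : Real.exp (-y) ≤ 1 - y + y ^ 2 / 2 := by
  have h := Real.quadratic_le_exp_of_nonneg hy
  have h2 : 0 < 1 + y + y ^ 2 / 2 := by positivity
  rw [Real.exp_neg]
  calc (Real.exp y)⁻¹ ≤ (1 + y + y ^ 2 / 2)⁻¹ := inv_anti₀ h2 h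
    _ ≤ 1 - y + y ^ 2 / 2 := by
      rw [inv_le_iff_one_le_mul₀ h2]
      nlinarith [sq_nonneg (y ^ 2)]

lemma potF_step {n : ℕ} (hn : 2 ≤ n) (G c x : Fin n → ℝ) {η : ℝ} (hη : 0 < η)
    (hc : ∀ i, c i ∈ Set.Icc (0 : ℝ) 1)
    (hx : ∀ i, x i = Real.exp (-η * G i) / ∑ j, Real.exp (-η * G j)) :
    ∑ i, c i * x i ≤ η * (∑ i, c i * x i) / 2 + (potF η (fun i => G i + c i) - potF η G) := by
  have hn0 : (0 : ℝ) < n := by positivity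
  have hS := sumexp_pos hn G η
  have hS' := sumexp_pos hn (fun i => G i + c i) η
  set S := ∑ j, Real.exp (-η * G j) with hSd
  have hx0 : ∀ i, 0 ≤ x i := fun i => by rw [hx]; positivity
  have hx1 : ∑ i, x i = 1 := by
    simp only [hx]; rw [← Finset.sum_div]; exact div_self hS.ne'
  have hr : (∑ i, Real.exp (-η * (G i + c i))) = S * ∑ i, x i * Real.exp (-(η * c i)) := by
    rw [Finset.mul_sum]
    refine Finset.sum_congr rfl fun i _ => ?_
    rw [hx, mul_add, Real.exp_add]
    field_simp
  have hq : ∑ i, x i * Real.exp (-(η * c i))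
      ≤ 1 - η * (∑ i, c i * x i) + η ^ 2 * (∑ i, c i * x i) / 2 := by
    calc ∑ i, x i * Real.exp (-(η * c i))
        ≤ ∑ i, (x i - η * (c i * x i) + η ^ 2 / 2 * (c i * x i)) := by
          refine Finset.sum_le_sum fun i _ => ?_
          have h1 := exp_neg_le (mul_nonneg hη.le (hc i).1)
          have h2 : (c i) ^ 2 ≤ c i := by nlinarith [(hc i).1, (hc i).2]
          have h3 : Real.exp (-(η * c i)) ≤ 1 - η * c i + η ^ 2 / 2 * c i := by
            nlinarith [mul_le_mul_of_nonneg_left h2 (sq_nonneg η)]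
          nlinarith [mul_le_mul_of_nonneg_left h3 (hx0 i)]
      _ = _ := by
          rw [Finset.sum_add_distrib, Finset.sum_sub_distrib, hx1, ← Finset.mul_sum,
            ← Finset.mul_sum]
          ring
  have hQ : 0 < ∑ i, x i * Real.exp (-(η * c i)) := by
    rw [hr] at hS'
    exact (mul_pos_iff_of_pos_left hS).1 hS'
  have hl := (Real.log_le_sub_one_of_pos hQ)
  have hd : potF η (fun i => G i + c i) - potF η G
      = -(1 / η) * Real.log (∑ i, x i * Real.exp (-(η * c i))) := by
    unfold potF
    rw [← Finset.mul_sum, ← Finset.mul_sum, hr, Real.log_mul (by positivity) (by positivity),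
      Real.log_mul hS.ne' hQ.ne', Real.log_mul (by positivity) hS.ne']
    ring
  rw [hd]
  set a := ∑ i, c i * x i
  have h5 : Real.log (∑ i, x i * Real.exp (-(η * c i))) ≤ - (η * a) + η ^ 2 * a / 2 := by
    linarith
  have h6 := mul_le_mul_of_nonneg_left h5 (by positivity : 0 ≤ 1 / η)
  have h7 : 1 / η * (- (η * a) + η ^ 2 * a / 2) = - a + η * a / 2 := by
    field_simp
  linarith

lemma potF_le {n : ℕ} (hn : 2 ≤ n) (G : Fin n → ℝ) {η : ℝ} (hη : 0 < η) (j : Fin n) :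
    potF η G ≤ G j + Real.log n / η := by
  have hn0 : (0 : ℝ) < n := by positivity
  have hS := sumexp_pos hn G η
  have h1 : Real.exp (-η * G j) ≤ ∑ i, Real.exp (-η * G i) :=
    Finset.single_le_sum (f := fun i => Real.exp (-η * G i))
      (fun i _ => (Real.exp_pos _).le) (Finset.mem_univ j)
  have h2 := Real.log_le_log (Real.exp_pos _) h1
  rw [Real.log_exp] at h2
  unfold potF
  rw [← Finset.mul_sum, Real.log_mul (by positivity) hS.ne', one_div (n : ℝ), Real.log_inv]
  have h6 := mul_le_mul_of_nonneg_left h2 (by positivity : 0 ≤ 1 / η)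
  have h7 : 1 / η * (-η * G j) = - G j := by field_simp
  have h8 : Real.log n / η = 1 / η * Real.log n := by ring
  rw [h8]
  linarith

lemma sqrt_step {A a : ℝ} (hA : 0 ≤ A) (ha : 0 ≤ a) (ha1 : a ≤ 1) :
    a / (2 * Real.sqrt (1 + A)) ≤ Real.sqrt (A + a) - Real.sqrt A := by
  have h1 : 0 < Real.sqrt (1 + A) := Real.sqrt_pos.2 (by linarith)
  have h2 : Real.sqrt (A + a) ≤ Real.sqrt (1 + A) := Real.sqrt_le_sqrt (by linarith)
  have h3 : Real.sqrt A ≤ Real.sqrt (A + a) := Real.sqrt_le_sqrt (by linarith)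
  have h4 := Real.sq_sqrt hA
  have h5 := Real.sq_sqrt (by linarith : 0 ≤ A + a)
  rw [div_le_iff₀ (by positivity)]
  have h6 : a = (Real.sqrt (A + a) - Real.sqrt A) * (Real.sqrt (A + a) + Real.sqrt A) := by
    nlinarith
  calc a = (Real.sqrt (A + a) - Real.sqrt A) * (Real.sqrt (A + a) + Real.sqrt A) := h6
    _ ≤ _ := mul_le_mul_of_nonneg_left (by linarith) (by linarith)

lemma final_arith {D A L : ℝ} (hD : 1 / 2 ≤ D) (hA : 0 ≤ A) (hL : 0 ≤ L)
    (h : A ≤ Real.sqrt D * Real.sqrt A + (L + Real.sqrt D * Real.sqrt (1 + A))) :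
    A - L ≤ 2 * Real.sqrt (D * L) + 8 * D := by
  have hD0 : 0 ≤ D := by linarith
  rw [Real.sqrt_mul hD0]
  have hm : Real.sqrt A ≤ Real.sqrt (1 + A) := Real.sqrt_le_sqrt (by linarith)
  have hu := Real.sq_sqrt (by linarith : 0 ≤ 1 + A)
  have hd := Real.sq_sqrt hD0
  have hl := Real.sq_sqrt hL
  have hu0 := Real.sqrt_nonneg (1 + A)
  have hd0 := Real.sqrt_nonneg D
  have hl0 := Real.sqrt_nonneg L
  set u := Real.sqrt (1 + A)
  set d := Real.sqrt D
  set l := Real.sqrt L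
  have h1 : A - L ≤ 2 * d * u := by
    nlinarith [mul_le_mul_of_nonneg_left hm hd0]
  have h2 : u ≤ l + 3 * d := by
    by_contra hc
    push Not at hc
    nlinarith [mul_nonneg hl0 hd0]
  nlinarith [mul_le_mul_of_nonneg_left h2 hd0]


theorem first_order_regret_bound {n : ℕ} (hn : 2 ≤ n)
    (g : ℕ → Fin n → ℝ) (hg : ∀ t, 1 ≤ t → ∀ i, g t i ∈ Set.Icc (0 : ℝ) 1)
    (A η : ℕ → ℝ) (x : ℕ → Fin n → ℝ)
    (hA0 : A 0 = 0)
    (hA : ∀ t, 1 ≤ t → A t = A (t - 1) + ∑ i, g t i * x t i)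
    (hη : ∀ t, 1 ≤ t → η t = Real.sqrt (Real.log n / (1 + A (t - 1))))
    (hx : ∀ t, 1 ≤ t → ∀ i, x t i =
      Real.exp (-(η t) * ∑ s ∈ Finset.Ico 1 t, g s i) /
        ∑ j, Real.exp (-(η t) * ∑ s ∈ Finset.Ico 1 t, g s j)) :
    ∀ T, 1 ≤ T → ∀ z ∈ stdSimplex ℝ (Fin n),
      ∑ t ∈ Finset.Icc 1 T, (∑ i, g t i * x t i)
        - ∑ t ∈ Finset.Icc 1 T, (∑ i, g t i * z i)
      ≤ 2 * Real.sqrt (Real.log n *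
          Finset.univ.inf' ⟨(⟨0, by omega⟩ : Fin n), Finset.mem_univ _⟩
            (fun j => ∑ t ∈ Finset.Icc 1 T, g t j))
        + 8 * Real.log n := by
  have hn0 : (0 : ℝ) < n := by positivity
  have hD : 1 / 2 ≤ Real.log n := by
    have h1 : Real.log 2 ≤ Real.log n := Real.log_le_log (by norm_num) (by exact_mod_cast hn)
    have := Real.log_two_gt_d9
    linarith
  have hD0 : 0 < Real.log n := by linarith
  have hS : ∀ t, 0 < ∑ j, Real.exp (-(η t) * ∑ s ∈ Finset.Ico 1 t, g s j) :=
    fun t => sumexp_pos hn (fun j => ∑ s ∈ Finset.Ico 1 t, g s j) (η t)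
  have hx0 : ∀ t, 1 ≤ t → ∀ i, 0 ≤ x t i := fun t ht i => by
    rw [hx t ht]; exact div_nonneg (Real.exp_pos _).le (hS t).le
  have hx1 : ∀ t, 1 ≤ t → ∑ i, x t i = 1 := fun t ht => by
    simp only [hx t ht]; rw [← Finset.sum_div]; exact div_self (hS t).ne'
  have ha0 : ∀ t, 1 ≤ t → 0 ≤ ∑ i, g t i * x t i := fun t ht =>
    Finset.sum_nonneg fun i _ => mul_nonneg (hg t ht i).1 (hx0 t ht i)
  have ha1 : ∀ t, 1 ≤ t → ∑ i, g t i * x t i ≤ 1 := fun t ht => by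
    rw [← hx1 t ht]
    exact Finset.sum_le_sum fun i _ => mul_le_of_le_one_left (hx0 t ht i) (hg t ht i).2
  have hAs : ∀ t, A (t + 1) = A t + ∑ i, g (t + 1) i * x (t + 1) i := fun t => by
    simpa using hA (t + 1) (by omega)
  have hηs : ∀ t, η (t + 1) = Real.sqrt (Real.log n) / Real.sqrt (1 + A t) := fun t => by
    have := hη (t + 1) (by omega)
    rw [Real.sqrt_div hD0.le] at this
    simpa using this
  have hAn : ∀ t, 0 ≤ A t := by
    intro t
    induction t with
    | zero => rw [hA0]
    | succ t ih => rw [hAs]; linarith [ha0 (t + 1) (by omega)]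
  have hsp : ∀ t, 0 < Real.sqrt (1 + A t) := fun t => Real.sqrt_pos.2 (by linarith [hAn t])
  have hdp : 0 < Real.sqrt (Real.log n) := Real.sqrt_pos.2 hD0
  have hηp : ∀ t, 0 < η (t + 1) := fun t => by rw [hηs]; exact div_pos hdp (hsp t)
  have hηm : ∀ t, η (t + 2) ≤ η (t + 1) := fun t => by
    rw [hηs t, hηs (t + 1)]
    refine div_le_div_of_nonneg_left hdp.le (hsp t) (Real.sqrt_le_sqrt ?_)
    rw [hAs]; linarith [ha0 (t + 1) (by omega)]
  have main : ∀ t, A t ≤ Real.sqrt (Real.log n) * Real.sqrt (A t)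
      + potF (η (t + 1)) (fun i => ∑ s ∈ Finset.Ico 1 (t + 1), g s i) := by
    intro t
    induction t with
    | zero =>
      have := potF_zero hn (η 1)
      simp [hA0, this]
    | succ t ih =>
      have e : (fun i => ∑ s ∈ Finset.Ico 1 (t + 1 + 1), g s i)
          = fun i => (∑ s ∈ Finset.Ico 1 (t + 1), g s i) + g (t + 1) i := by
        funext i
        rw [Finset.sum_Ico_succ_top (by omega)]
      have h1 := potF_step hn (fun i => ∑ s ∈ Finset.Ico 1 (t + 1), g s i) (g (t + 1)) (x (t + 1))
        (hηp t) (hg (t + 1) (by omega)) (hx (t + 1) (by omega))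
      have h2 := potF_anti hn (fun i => (∑ s ∈ Finset.Ico 1 (t + 1), g s i) + g (t + 1) i)
        (hηp (t + 1)) (hηm t)
      have h3 := sqrt_step (hAn t) (ha0 (t + 1) (by omega)) (ha1 (t + 1) (by omega))
      rw [e, hAs]
      set a := ∑ i, g (t + 1) i * x (t + 1) i
      have h4 : η (t + 1) * a / 2 = Real.sqrt (Real.log n) * (a / (2 * Real.sqrt (1 + A t))) := by
        rw [hηs]; have := (hsp t).ne'; field_simp
      have h5 := mul_le_mul_of_nonneg_left h3 hdp.le
      linarith
  intro T hT z hz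
  have hAT : ∀ t, ∑ t ∈ Finset.Icc 1 t, (∑ i, g t i * x t i) = A t := by
    intro t
    induction t with
    | zero => simp [hA0]
    | succ t ih => rw [Finset.sum_Icc_succ_top (by omega), ih, hAs]
  have hIc : Finset.Ico 1 (T + 1) = Finset.Icc 1 T := by ext; simp
  rw [hAT]
  obtain ⟨j, -, hj⟩ := Finset.exists_mem_eq_inf' (s := Finset.univ)
    ⟨(⟨0, by omega⟩ : Fin n), Finset.mem_univ _⟩ (fun j => ∑ t ∈ Finset.Icc 1 T, g t j)
  have hLz : Finset.univ.inf' ⟨(⟨0, by omega⟩ : Fin n), Finset.mem_univ _⟩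
      (fun j => ∑ t ∈ Finset.Icc 1 T, g t j) ≤ ∑ t ∈ Finset.Icc 1 T, (∑ i, g t i * z i) := by
    rw [Finset.sum_comm]
    simp only [← Finset.sum_mul]
    set L := Finset.univ.inf' ⟨(⟨0, by omega⟩ : Fin n), Finset.mem_univ _⟩
      (fun j => ∑ t ∈ Finset.Icc 1 T, g t j) with hL
    calc L = ∑ i, L * z i := by rw [← Finset.mul_sum, hz.2, mul_one]
      _ ≤ _ := Finset.sum_le_sum fun i _ => mul_le_mul_of_nonneg_right
        (Finset.inf'_le (fun j => ∑ t ∈ Finset.Icc 1 T, g t j) (Finset.mem_univ i)) (hz.1 i)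
  rw [hj] at hLz ⊢
  have hm := main T
  have hp := potF_le hn (fun i => ∑ s ∈ Finset.Ico 1 (T + 1), g s i) (hηp T) j
  simp only [hIc] at hm hp
  have hde : Real.log n / η (T + 1) = Real.sqrt (Real.log n) * Real.sqrt (1 + A T) := by
    rw [hηs, div_div_eq_mul_div, div_eq_iff hdp.ne']
    have := Real.mul_self_sqrt hD0.le
    linear_combination (-Real.sqrt (1 + A T)) * this
  rw [hde] at hp
  have hL0 : 0 ≤ ∑ t ∈ Finset.Icc 1 T, g t j :=
    Finset.sum_nonneg fun t ht => (hg t (Finset.mem_Icc.1 ht).1 j).1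
  have := final_arith hD (hAn T) hL0 (by linarith)
  linarith
end

section
/- Second-order bound on Λ after an entropic gradient step (Proposition 3). Let a ∈ Δ_n, q ∈ [0,1]ⁿ and η > 0. Define c ∈ ℝ_{>0}ⁿ by c(i) := a(i)·exp(−η q(i)) when a(i) > 0 (and any positive value with c(i) = a(i)·exp(−η q(i)) still applies coordinatewise since a(i) = 0 contributes 0). Then Λ(a, c) = η⟨a, q⟩ + ln(Σ_i a(i)·exp(−η q(i))) ≤ η² ⟨a, q⟩ / 2. Equivalently: for every a ∈ Δ_n, q ∈ [0,1]ⁿ and η > 0, η·Σ_i a(i)q(i) + ln(Σ_i a(i)·exp(−η q(i))) ≤ (η²/2)·Σ_i a(i)q(i). -/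
/-! Second-order bound on Λ after an entropic gradient step (Proposition 3).
Stated in the equivalent explicit form:
`η⟨a,q⟩ + ln(Σ_i a_i exp(−η q_i)) ≤ (η²/2)⟨a,q⟩` for `a ∈ Δ_n`, `q ∈ [0,1]ⁿ`, `η > 0`. -/

open scoped BigOperators

theorem exp_neg_le_quad (x : ℝ) (hx : 0 ≤ x) : Real.exp (-x) ≤ 1 - x + x ^ 2 / 2 := by
  have h := Real.quadratic_le_exp_of_nonneg hx
  have hp := Real.exp_pos x
  have hpos : 0 ≤ 1 - x + x ^ 2 / 2 := by nlinarith [sq_nonneg (x - 1)]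
  rw [Real.exp_neg, inv_le_iff_one_le_mul₀ hp]
  have h2 := mul_le_mul_of_nonneg_left h hpos
  nlinarith [sq_nonneg (x ^ 2)]

theorem Lam_entropic_step_bound {n : ℕ} (a q : Fin n → ℝ) (η : ℝ)
    (ha : a ∈ stdSimplex ℝ (Fin n)) (hq : ∀ i, q i ∈ Set.Icc (0 : ℝ) 1)
    (hη : 0 < η) :
    η * ∑ i, a i * q i + Real.log (∑ i, a i * Real.exp (-η * q i)) ≤
      η ^ 2 / 2 * ∑ i, a i * q i := by
  obtain ⟨h0, h1⟩ := ha
  have hpos : 0 < ∑ i, a i * Real.exp (-η * q i) := by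
    have hnn : ∀ i ∈ Finset.univ, 0 ≤ a i * Real.exp (-η * q i) :=
      fun i _ => mul_nonneg (h0 i) (Real.exp_pos _).le
    refine lt_of_le_of_ne (Finset.sum_nonneg hnn) fun h => ?_
    have hz := (Finset.sum_eq_zero_iff_of_nonneg hnn).1 h.symm
    have hz' : ∑ i, a i = 0 := Finset.sum_eq_zero fun i hi =>
      (mul_eq_zero.1 (hz i hi)).resolve_right (Real.exp_pos _).ne'
    rw [h1] at hz'
    exact one_ne_zero hz'
  have hlog := Real.log_le_sub_one_of_pos hpos
  have hS : ∑ i, a i * Real.exp (-η * q i)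
      ≤ ∑ i, (a i - η * (a i * q i) + η ^ 2 / 2 * (a i * q i)) := by
    refine Finset.sum_le_sum fun i _ => ?_
    obtain ⟨hq0, hq1⟩ := hq i
    have h := exp_neg_le_quad (η * q i) (by positivity)
    have hqq : q i ^ 2 ≤ q i := by nlinarith
    have h3 : Real.exp (-η * q i) ≤ 1 - η * q i + η ^ 2 / 2 * q i := by
      rw [neg_mul]
      have := mul_le_mul_of_nonneg_left hqq (by positivity : 0 ≤ η ^ 2 / 2)
      nlinarith
    have := mul_le_mul_of_nonneg_left h3 (h0 i)
    linarith
  rw [Finset.sum_add_distrib, Finset.sum_sub_distrib, ← Finset.mul_sum, ← Finset.mul_sum,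
    h1] at hS
  linarith
end

section
/- Proximal formulation of dual-stabilized OMD (Proposition 4). Let η_t > 0 and γ_t ∈ (0,1]. Let x_t, x_1 ∈ X ∩ D and g_t ∈ ℝⁿ, and let w_{t+1}, y_{t+1} ∈ D and x_{t+1} ∈ X ∩ D satisfy: ∇Φ(w_{t+1}) = ∇Φ(x_t) − η_t g_t; ∇Φ(y_{t+1}) = γ_t ∇Φ(w_{t+1}) + (1−γ_t) ∇Φ(x_1); and D_Φ(x_{t+1}, y_{t+1}) ≤ D_Φ(x, y_{t+1}) for all x ∈ X. Then x_{t+1} is the unique minimizer over X of the function x ↦ γ_t·(η_t⟨g_t, x⟩ + D_Φ(x, x_t)) + (1−γ_t)·D_Φ(x, x_1). -/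
/-! Proximal formulation of dual-stabilized OMD (Proposition 4). -/

open scoped RealInnerProductSpace BigOperators

theorem ds_omd_proximal_formulation {n : ℕ}
    (D X : Set (EuclideanSpace ℝ (Fin n)))
    (Φ : EuclideanSpace ℝ (Fin n) → ℝ)
    (Φ' : EuclideanSpace ℝ (Fin n) → EuclideanSpace ℝ (Fin n))
    -- mirror map setup
    (hDopen : IsOpen D) (hDconv : Convex ℝ D) (hDne : D.Nonempty)
    (hΦconv : ConvexOn ℝ (closure D) Φ)
    (hΦstrict : StrictConvexOn ℝ D Φ)
    (hΦgrad : ∀ y ∈ D, HasGradientAt Φ (Φ' y) y)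
    (hΦbij : Set.BijOn Φ' D Set.univ)
    (hXclosed : IsClosed X) (hXconv : Convex ℝ X)
    (hXsub : X ⊆ closure D) (hXDne : (X ∩ D).Nonempty)
    -- parameters and one step of the algorithm
    (ηt : ℝ) (hηt : 0 < ηt) (γt : ℝ) (hγt : γt ∈ Set.Ioc (0 : ℝ) 1)
    (x1 xt : EuclideanSpace ℝ (Fin n)) (hx1 : x1 ∈ X ∩ D) (hxt : xt ∈ X ∩ D)
    (gt : EuclideanSpace ℝ (Fin n))
    (wnext ynext : EuclideanSpace ℝ (Fin n)) (hwnext : wnext ∈ D) (hynext : ynext ∈ D)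
    (xnext : EuclideanSpace ℝ (Fin n)) (hxnext : xnext ∈ X ∩ D)
    (hwstep : Φ' wnext = Φ' xt - ηt • gt)
    (hystep : Φ' ynext = γt • Φ' wnext + (1 - γt) • Φ' x1)
    (hproj : ∀ u ∈ X, bregman Φ Φ' xnext ynext ≤ bregman Φ Φ' u ynext) :
    ({xnext} : Set (EuclideanSpace ℝ (Fin n))) =
      {u | u ∈ X ∧ ∀ v ∈ X,
        γt * (ηt * ⟪gt, u⟫ + bregman Φ Φ' u xt) + (1 - γt) * bregman Φ Φ' u x1 ≤
        γt * (ηt * ⟪gt, v⟫ + bregman Φ Φ' v xt) + (1 - γt) * bregman Φ Φ' v x1} := by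
  have key : ∀ u, γt * (ηt * ⟪gt, u⟫ + bregman Φ Φ' u xt) + (1 - γt) * bregman Φ Φ' u x1 =
      (Φ u - ⟪Φ' ynext, u⟫) + (γt * (⟪Φ' xt, xt⟫ - Φ xt) + (1 - γt) * (⟪Φ' x1, x1⟫ - Φ x1)) := by
    intro u
    rw [hystep, hwstep]
    simp only [bregman, inner_sub_right, inner_add_left, inner_sub_left, real_inner_smul_left]
    ring
  have hp : ∀ u ∈ X, Φ xnext - ⟪Φ' ynext, xnext⟫ ≤ Φ u - ⟪Φ' ynext, u⟫ := by
    intro u hu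
    have := hproj u hu
    simp only [bregman, inner_sub_right] at this
    linarith
  ext u
  simp only [Set.mem_singleton_iff, Set.mem_ofPred_eq, key, add_le_add_iff_right]
  constructor
  · rintro rfl
    exact ⟨hxnext.1, hp⟩
  · rintro ⟨hu, hmin⟩
    by_contra hne
    have hu1 := hmin xnext hxnext.1
    have hcont : Continuous (fun t : ℝ => (1 - t) • xnext + t • u) := by fun_prop
    have hev : ∀ᶠ t in nhds (0 : ℝ), (1 - t) • xnext + t • u ∈ D :=
      hcont.continuousAt.eventually_mem (hDopen.mem_nhds (by simpa using hxnext.2))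
    obtain ⟨ε, hε, hball⟩ := Metric.eventually_nhds_iff.1 hev
    obtain ⟨t, ht0, ht1, htε⟩ : ∃ t : ℝ, 0 < t ∧ t ≤ 1 ∧ t < ε :=
      ⟨min 1 (ε / 2), by positivity, min_le_left _ _, by
        have := min_le_right 1 (ε / 2)
        linarith⟩
    have hpD := hball (y := t) (by rw [Real.dist_eq, sub_zero, abs_of_pos ht0]; exact htε)
    have hpX : (1 - t) • xnext + t • u ∈ X :=
      hXconv hxnext.1 hu (by linarith) ht0.le (by ring)
    have hc := hΦconv.2 (hXsub hxnext.1) (hXsub hu)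
      (show (0 : ℝ) ≤ 1 - t by linarith) ht0.le (by ring)
    have hin : ⟪Φ' ynext, (1 - t) • xnext + t • u⟫ =
        (1 - t) * ⟪Φ' ynext, xnext⟫ + t * ⟪Φ' ynext, u⟫ := by
      simp only [inner_add_right, real_inner_smul_right]
    have hpne : xnext ≠ (1 - t) • xnext + t • u := by
      intro h
      apply hne
      have h2 : t • (u - xnext) = 0 := by
        have h3 : t • (u - xnext) = ((1 - t) • xnext + t • u) - xnext := by module
        rw [h3, ← h, sub_self]
      rcases smul_eq_zero.1 h2 with h4 | h4
      · exact absurd h4 ht0.ne'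
      · exact sub_eq_zero.1 h4
    generalize (1 - t) • xnext + t • u = p at *
    have hs := hΦstrict.2 hxnext.2 hpD hpne
      (show (0 : ℝ) < 1 / 2 by norm_num) (show (0 : ℝ) < 1 / 2 by norm_num) (by norm_num)
    have hm := hp _ (hXconv hxnext.1 hpX
      (show (0 : ℝ) ≤ 1 / 2 by norm_num) (show (0 : ℝ) ≤ 1 / 2 by norm_num) (by norm_num))
    simp only [inner_add_right, real_inner_smul_right, smul_eq_mul] at hs hm hc
    have := mul_le_mul_of_nonneg_left hu1 ht0.le
    linarith
end

section
/- FTRL-type formula for OMD iterates (Theorem 4, case γ_t = 1). Let η : ℕ → ℝ_{>0}. Let sequences {x_t}_{t≥1} ⊆ X ∩ D, {w_t}_{t≥2} ⊆ D and {g_t}_{t≥1} ⊆ ℝⁿ satisfy for every t ≥ 1: ∇Φ(w_{t+1}) = ∇Φ(x_t) − η_t g_t and x_{t+1} ∈ X ∩ D satisfies D_Φ(x_{t+1}, w_{t+1}) ≤ D_Φ(x, w_{t+1}) for all x ∈ X. Then there exist vectors {p_t}_{t≥1} with p_t ∈ N_X(x_t) for all t ≥ 1 such that, for every t ≥ 0,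 x_{t+1} is the unique minimizer over X of the function x ↦ Σ_{i=1}^t ⟨η_i g_i + p_i, x⟩ − ⟨∇Φ(x_1), x⟩ + Φ(x). -/
/-! FTRL-type formula for OMD iterates (Theorem 4, case γ_t = 1). -/

open scoped RealInnerProductSpace BigOperators

/-- The normal cone of `X` at `x`: `{p : ⟨p, z − x⟩ ≤ 0 for all z ∈ X}`. -/
def normalCone {n : ℕ} (X : Set (EuclideanSpace ℝ (Fin n)))
    (x : EuclideanSpace ℝ (Fin n)) : Set (EuclideanSpace ℝ (Fin n)) :=
  {p | ∀ z ∈ X, ⟪p, z - x⟫ ≤ 0}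

lemma omd_normal {n : ℕ} {X : Set (EuclideanSpace ℝ (Fin n))}
    {Φ : EuclideanSpace ℝ (Fin n) → ℝ} {d q y z : EuclideanSpace ℝ (Fin n)}
    (hX : Convex ℝ X) (hg : HasGradientAt Φ d y) (hy : y ∈ X) (hz : z ∈ X)
    (hmin : ∀ v ∈ X, Φ y - ⟪q, y⟫ ≤ Φ v - ⟪q, v⟫) : ⟪q - d, z - y⟫ ≤ 0 := by
  have h1 : HasFDerivAt (fun v => Φ v - ⟪q, v⟫)
      (InnerProductSpace.toDual ℝ _ d - innerSL ℝ q) y :=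
    hg.hasFDerivAt.sub (innerSL ℝ q).hasFDerivAt
  have h2 : IsLocalMinOn (fun v => Φ v - ⟪q, v⟫) X y :=
    IsMinOn.localize (fun v hv => hmin v hv)
  have h3 := h2.hasFDerivWithinAt_nonneg h1.hasFDerivWithinAt
    (sub_mem_posTangentConeAt_of_segment_subset (hX.segment_subset hy hz))
  simp only [ContinuousLinearMap.sub_apply, InnerProductSpace.toDual_apply_apply,
    innerSL_apply_apply] at h3
  rw [inner_sub_left]
  linarith

lemma omd_grad_ineq {n : ℕ} {S : Set (EuclideanSpace ℝ (Fin n))}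
    {Φ : EuclideanSpace ℝ (Fin n) → ℝ} {d y u : EuclideanSpace ℝ (Fin n)}
    (hc : ConvexOn ℝ S Φ) (hg : HasGradientAt Φ d y) (hy : y ∈ S) (hu : u ∈ S) :
    Φ y - ⟪d, y⟫ ≤ Φ u - ⟪d, u⟫ := by
  have h1 := hc.comp_affineMap (AffineMap.lineMap (k := ℝ) y u)
  have h2 : HasDerivAt (Φ ∘ (AffineMap.lineMap (k := ℝ) y u)) (⟪d, u - y⟫) 0 := by
    have h3 : HasFDerivAt Φ (InnerProductSpace.toDual ℝ _ d)
      (AffineMap.lineMap (k := ℝ) y u 0) := by simpa using hg.hasFDerivAt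
    simpa using h3.comp_hasDerivAt 0 (AffineMap.hasDerivAt_lineMap (a := y) (b := u) (x := (0:ℝ)))
  have h4 := h1.le_slope_of_hasDerivAt (x := 0) (y := 1) (by simpa using hy) (by simpa using hu)
    one_pos h2
  simp [slope_def_field, inner_sub_right] at h4
  linarith

lemma omd_unique {n : ℕ} {D X : Set (EuclideanSpace ℝ (Fin n))}
    {Φ : EuclideanSpace ℝ (Fin n) → ℝ} {q y u : EuclideanSpace ℝ (Fin n)}
    (hD : IsOpen D) (hXD : X ⊆ closure D) (hX : Convex ℝ X)
    (hc : ConvexOn ℝ (closure D) Φ) (hs : StrictConvexOn ℝ D Φ)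
    (hy : y ∈ X) (hyD : y ∈ D) (hu : u ∈ X)
    (hmin : ∀ v ∈ X, Φ y - ⟪q, y⟫ ≤ Φ v - ⟪q, v⟫)
    (hle : Φ u - ⟪q, u⟫ ≤ Φ y - ⟪q, y⟫) : u = y := by
  by_contra hne
  have hcont : Filter.Tendsto (fun s : ℝ => (1 - s) • y + s • u) (nhdsWithin 0 (Set.Ioi 0))
      (nhds y) := by
    have : Continuous (fun s : ℝ => (1 - s) • y + s • u) := by fun_prop
    have h := this.tendsto 0
    simp only [sub_zero, one_smul, zero_smul, add_zero] at h
    exact h.mono_left nhdsWithin_le_nhds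
  obtain ⟨s, hsD, hs0, hs1⟩ := ((hcont.eventually (hD.mem_nhds hyD)).and
    (Ioo_mem_nhdsGT (zero_lt_one (α := ℝ)))).exists
  set z := (1 - s) • y + s • u with hz
  have hzX : z ∈ X := hX hy hu (by linarith) hs0.le (by ring)
  have hzy : y ≠ z := by
    intro h
    have : s • (u - y) = 0 := by
      have h5 : s • (u - y) = z - y := by rw [hz]; module
      rw [h5, ← h, sub_self]
    rcases smul_eq_zero.1 this with h | h
    · linarith
    · exact hne (sub_eq_zero.1 h)
  have h1 := hc.2 (hXD hy) (hXD hu) (by linarith : 0 ≤ 1 - s) hs0.le (by ring)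
  have h2 := hs.2 hyD hsD hzy (by norm_num : (0:ℝ) < 1/2) (by norm_num : (0:ℝ) < 1/2) (by norm_num)
  have h3 := hmin _ (hX hy hzX (by norm_num : (0:ℝ) ≤ 1/2) (by norm_num : (0:ℝ) ≤ 1/2)
    (by norm_num))
  have h4 : ⟪q, z⟫ = (1 - s) * ⟪q, y⟫ + s * ⟪q, u⟫ := by
    rw [hz, inner_add_right, inner_smul_right, inner_smul_right]
  rw [inner_add_right, inner_smul_right, inner_smul_right] at h3
  rw [← hz] at h1
  simp only [smul_eq_mul] at h1 h2
  have h6 := mul_le_mul_of_nonneg_left hle hs0.le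
  linarith

theorem omd_ftrl_formula {n : ℕ}
    (D X : Set (EuclideanSpace ℝ (Fin n)))
    (Φ : EuclideanSpace ℝ (Fin n) → ℝ)
    (Φ' : EuclideanSpace ℝ (Fin n) → EuclideanSpace ℝ (Fin n))
    -- mirror map setup
    (hDopen : IsOpen D) (hDconv : Convex ℝ D) (hDne : D.Nonempty)
    (hΦconv : ConvexOn ℝ (closure D) Φ)
    (hΦstrict : StrictConvexOn ℝ D Φ)
    (hΦgrad : ∀ y ∈ D, HasGradientAt Φ (Φ' y) y)
    (hΦbij : Set.BijOn Φ' D Set.univ)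
    (hXclosed : IsClosed X) (hXconv : Convex ℝ X)
    (hXsub : X ⊆ closure D) (hXDne : (X ∩ D).Nonempty)
    -- learning rates
    (η : ℕ → ℝ) (hη : ∀ t, 0 < η t)
    -- OMD iterates
    (x w g : ℕ → EuclideanSpace ℝ (Fin n))
    (hx : ∀ t, 1 ≤ t → x t ∈ X ∩ D)
    (hw : ∀ t, 2 ≤ t → w t ∈ D)
    (hwstep : ∀ t, 1 ≤ t → Φ' (w (t + 1)) = Φ' (x t) - η t • g t)
    (hproj : ∀ t, 1 ≤ t → ∀ u ∈ X,
      bregman Φ Φ' (x (t + 1)) (w (t + 1)) ≤ bregman Φ Φ' u (w (t + 1))) :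
    ∃ p : ℕ → EuclideanSpace ℝ (Fin n),
      (∀ t, 1 ≤ t → p t ∈ normalCone X (x t)) ∧
      ∀ t : ℕ, ({x (t + 1)} : Set (EuclideanSpace ℝ (Fin n))) =
        {u | u ∈ X ∧ ∀ v ∈ X,
          (∑ i ∈ Finset.Icc 1 t, ⟪η i • g i + p i, u⟫) - ⟪Φ' (x 1), u⟫ + Φ u ≤
          (∑ i ∈ Finset.Icc 1 t, ⟪η i • g i + p i, v⟫) - ⟪Φ' (x 1), v⟫ + Φ v} := by
  set Q : ℕ → EuclideanSpace ℝ (Fin n) :=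
    fun t => if t = 0 then Φ' (x 1) else Φ' (w (t + 1)) with hQ
  have hmin : ∀ t, ∀ v ∈ X, Φ (x (t + 1)) - ⟪Q t, x (t + 1)⟫ ≤ Φ v - ⟪Q t, v⟫ := by
    intro t v hv
    rcases Nat.eq_zero_or_pos t with rfl | ht
    · have h1 := hx 1 le_rfl
      simpa [hQ] using omd_grad_ineq hΦconv (hΦgrad _ h1.2) (hXsub h1.1) (hXsub hv)
    · have h1 := hproj t ht v hv
      simp only [bregman, inner_sub_right] at h1
      simp only [hQ, ht.ne', if_false]
      linarith
  have hsum : ∀ t u, (∑ i ∈ Finset.Icc 1 t, ⟪η i • g i + (Q (i - 1) - Φ' (x i)), u⟫)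
      - ⟪Φ' (x 1), u⟫ = - ⟪Q t, u⟫ := by
    intro t u
    induction t with
    | zero => simp [hQ]
    | succ t ih =>
      rw [Finset.sum_Icc_succ_top (by omega), Nat.add_sub_cancel]
      have h1 : Q (t + 1) = Φ' (x (t + 1)) - η (t + 1) • g (t + 1) := by
        simp only [hQ, Nat.succ_ne_zero, if_false]
        exact hwstep (t + 1) (by omega)
      rw [h1]
      simp only [inner_add_left, inner_sub_left] at ih ⊢
      linarith
  refine ⟨fun i => Q (i - 1) - Φ' (x i), ?_, ?_⟩
  · intro t ht z hz
    obtain ⟨s, rfl⟩ : ∃ s, t = s + 1 := ⟨t - 1, by omega⟩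
    have h1 := hx (s + 1) ht
    exact omd_normal hXconv (hΦgrad _ h1.2) h1.1 hz (hmin s)
  · intro t
    have h1 := hx (t + 1) (by omega)
    ext u
    simp only [Set.mem_singleton_iff, Set.mem_setOf_eq, hsum]
    constructor
    · rintro rfl
      refine ⟨h1.1, fun v hv => ?_⟩
      have := hmin t v hv
      linarith
    · rintro ⟨hu, h⟩
      refine omd_unique hDopen hXsub hXconv hΦconv hΦstrict h1.1 h1.2 hu (hmin t) ?_
      have := h _ h1.1
      linarith
end

section
/- FTRL-type formula for dual-stabilized OMD iterates (Theorem 4, case γ_t = η_{t+1}/η_t). Let η : ℕ → ℝ_{>0} be nonincreasing and set γ_t := η_{t+1}/η_t. Let sequences {x_t}_{t≥1} ⊆ X ∩ D, {w_t}_{t≥2}, {y_t}_{t≥2} ⊆ D and {g_t}_{t≥1} ⊆ ℝⁿ satisfy for every t ≥ 1: ∇Φ(w_{t+1}) = ∇Φ(x_t) − η_t g_t; ∇Φ(y_{t+1}) = γ_t ∇Φ(w_{t+1}) + (1−γ_t) ∇Φ(x_1); and x_{t+1} ∈ X ∩ D satisfies D_Φ(x_{t+1}, y_{t+1}) ≤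 D_Φ(x, y_{t+1}) for all x ∈ X. Then there exist vectors {p'_t}_{t≥1} with p'_t ∈ N_X(x_t) for all t ≥ 1 such that, for every t ≥ 0, x_{t+1} is the unique minimizer over X of the function x ↦ η_{t+1} Σ_{i=1}^t ⟨g_i + p'_i, x⟩ − ⟨∇Φ(x_1), x⟩ + Φ(x). -/
/-! FTRL-type formula for dual-stabilized OMD iterates
(Theorem 4, case γ_t = η_{t+1}/η_t). -/

open scoped RealInnerProductSpace BigOperators

theorem aux_slope_s15 (φ : ℝ → ℝ) (d c : ℝ) (h : HasDerivAt φ d 0)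
    (hle : ∀ s : ℝ, 0 < s → s ≤ 1 → φ s ≤ φ 0 + s * c) : d ≤ c := by
  have h1 := h.hasDerivWithinAt (s := Set.Ioi (0:ℝ))
  rw [hasDerivWithinAt_iff_tendsto_slope' (by simp)] at h1
  refine le_of_tendsto h1 ?_
  filter_upwards [Ioc_mem_nhdsGT (zero_lt_one (α := ℝ))] with s hs
  rw [slope_def_field, sub_zero, div_le_iff₀ hs.1]
  have := hle s hs.1 hs.2
  linarith

theorem aux_line {n : ℕ} (Φ : EuclideanSpace ℝ (Fin n) → ℝ)
    (p a v : EuclideanSpace ℝ (Fin n)) (h : HasGradientAt Φ p a) :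
    HasDerivAt (fun s : ℝ => Φ (a + s • (v - a))) ⟪p, v - a⟫ 0 := by
  have h1 := h.hasFDerivAt
  have h2 : HasDerivAt (fun s : ℝ => a + s • (v - a)) (v - a) 0 := by
    simpa using ((hasDerivAt_id (0:ℝ)).smul_const (v - a)).const_add a
  have h3 : HasFDerivAt Φ ((InnerProductSpace.toDual ℝ _) p) (a + (0:ℝ) • (v - a)) := by
    simpa using h1
  have h4 := h3.comp_hasDerivAt (0:ℝ) h2
  rw [InnerProductSpace.toDual_apply_apply] at h4
  exact h4

theorem aux_comb {n : ℕ} (a v : EuclideanSpace ℝ (Fin n)) (s : ℝ) :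
    a + s • (v - a) = (1 - s) • a + s • v := by module

theorem aux_grad {n : ℕ} (D : Set (EuclideanSpace ℝ (Fin n)))
    (Φ : EuclideanSpace ℝ (Fin n) → ℝ) (hΦconv : ConvexOn ℝ (closure D) Φ)
    (p a v : EuclideanSpace ℝ (Fin n)) (h : HasGradientAt Φ p a)
    (ha : a ∈ D) (hv : v ∈ closure D) : ⟪p, v - a⟫ ≤ Φ v - Φ a := by
  refine aux_slope_s15 _ _ _ (aux_line Φ p a v h) ?_
  intro s hs hs1
  have := hΦconv.2 (subset_closure ha) hv (by linarith : 0 ≤ 1 - s) hs.le (by ring)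
  simp only [aux_comb, smul_eq_mul] at this ⊢
  simp only [sub_zero, one_smul, zero_smul, add_zero]
  linarith

theorem aux_grad_strict {n : ℕ} (D : Set (EuclideanSpace ℝ (Fin n)))
    (Φ : EuclideanSpace ℝ (Fin n) → ℝ) (hDopen : IsOpen D) (hDconv : Convex ℝ D)
    (hΦconv : ConvexOn ℝ (closure D) Φ) (hΦstrict : StrictConvexOn ℝ D Φ)
    (p a v : EuclideanSpace ℝ (Fin n)) (h : HasGradientAt Φ p a)
    (ha : a ∈ D) (hv : v ∈ closure D) (hne : v ≠ a) : ⟪p, v - a⟫ < Φ v - Φ a := by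
  have key : ∀ z ∈ D, z ≠ a → ⟪p, z - a⟫ < Φ z - Φ a := by
    intro z hz hza
    have hm := hΦstrict.2 ha hz hza.symm (by norm_num : (0:ℝ) < 1/2)
      (by norm_num : (0:ℝ) < 1/2) (by norm_num)
    have hmD := hDconv ha hz (by norm_num : (0:ℝ) ≤ 1/2)
      (by norm_num : (0:ℝ) ≤ 1/2) (by norm_num)
    have hg := aux_grad D Φ hΦconv p a _ h ha (subset_closure hmD)
    have e : (1/2:ℝ) • a + (1/2:ℝ) • z - a = (1/2:ℝ) • (z - a) := by module
    rw [e, real_inner_smul_right] at hg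
    simp only [smul_eq_mul] at hm
    linarith
  have hmD : (1/2:ℝ) • a + (1/2:ℝ) • v ∈ D := by
    have := hDconv.combo_interior_closure_mem_interior (x := a) (y := v)
      (by rwa [hDopen.interior_eq]) hv (by norm_num : (0:ℝ) < 1/2)
      (by norm_num : (0:ℝ) ≤ 1/2) (by norm_num)
    rwa [hDopen.interior_eq] at this
  have e : (1/2:ℝ) • a + (1/2:ℝ) • v - a = (1/2:ℝ) • (v - a) := by module
  have hm := hΦconv.2 (subset_closure ha) hv (by norm_num : (0:ℝ) ≤ 1/2)
      (by norm_num : (0:ℝ) ≤ 1/2) (by norm_num)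
  have hk := key _ hmD (by
    intro h0
    rw [← sub_eq_zero, e] at h0
    have : v - a = 0 := by simpa using h0
    exact hne (sub_eq_zero.1 this))
  rw [e, real_inner_smul_right] at hk
  simp only [smul_eq_mul] at hm
  linarith

theorem aux_normal {n : ℕ} (X : Set (EuclideanSpace ℝ (Fin n)))
    (Φ : EuclideanSpace ℝ (Fin n) → ℝ)
    (Φ' : EuclideanSpace ℝ (Fin n) → EuclideanSpace ℝ (Fin n))
    (hXconv : Convex ℝ X) (a b : EuclideanSpace ℝ (Fin n))
    (h : HasGradientAt Φ (Φ' a) a) (ha : a ∈ X)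
    (hp : ∀ u ∈ X, bregman Φ Φ' a b ≤ bregman Φ Φ' u b) :
    Φ' b - Φ' a ∈ normalCone X a := by
  intro z hz
  have := aux_slope_s15 _ (-⟪Φ' a, z - a⟫) (-⟪Φ' b, z - a⟫) (aux_line Φ (Φ' a) a z h).neg ?_
  · rw [inner_sub_left]; linarith
  intro s hs hs1
  have hm := hXconv ha hz (by linarith : 0 ≤ 1 - s) hs.le (by ring)
  have h1 := hp _ hm
  rw [← aux_comb] at h1
  unfold bregman at h1
  have e : a + s • (z - a) - b = (a - b) + s • (z - a) := by module
  rw [e, inner_add_right, real_inner_smul_right] at h1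
  simp only [Pi.neg_apply, zero_smul, add_zero]
  linarith

theorem ds_omd_ftrl_formula {n : ℕ}
    (D X : Set (EuclideanSpace ℝ (Fin n)))
    (Φ : EuclideanSpace ℝ (Fin n) → ℝ)
    (Φ' : EuclideanSpace ℝ (Fin n) → EuclideanSpace ℝ (Fin n))
    -- mirror map setup
    (hDopen : IsOpen D) (hDconv : Convex ℝ D) (hDne : D.Nonempty)
    (hΦconv : ConvexOn ℝ (closure D) Φ)
    (hΦstrict : StrictConvexOn ℝ D Φ)
    (hΦgrad : ∀ y ∈ D, HasGradientAt Φ (Φ' y) y)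
    (hΦbij : Set.BijOn Φ' D Set.univ)
    (hXclosed : IsClosed X) (hXconv : Convex ℝ X)
    (hXsub : X ⊆ closure D) (hXDne : (X ∩ D).Nonempty)
    -- learning rates and stabilization parameters
    (η : ℕ → ℝ) (hη : ∀ t, 0 < η t) (hηmono : ∀ t, η (t + 1) ≤ η t)
    (γ : ℕ → ℝ) (hγ : ∀ t, γ t = η (t + 1) / η t)
    -- DS-OMD iterates
    (x w y g : ℕ → EuclideanSpace ℝ (Fin n))
    (hx : ∀ t, 1 ≤ t → x t ∈ X ∩ D)
    (hw : ∀ t, 2 ≤ t → w t ∈ D)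
    (hy : ∀ t, 2 ≤ t → y t ∈ D)
    (hwstep : ∀ t, 1 ≤ t → Φ' (w (t + 1)) = Φ' (x t) - η t • g t)
    (hystep : ∀ t, 1 ≤ t →
      Φ' (y (t + 1)) = γ t • Φ' (w (t + 1)) + (1 - γ t) • Φ' (x 1))
    (hproj : ∀ t, 1 ≤ t → ∀ u ∈ X,
      bregman Φ Φ' (x (t + 1)) (y (t + 1)) ≤ bregman Φ Φ' u (y (t + 1))) :
    ∃ p' : ℕ → EuclideanSpace ℝ (Fin n),
      (∀ t, 1 ≤ t → p' t ∈ normalCone X (x t)) ∧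
      ∀ t : ℕ, ({x (t + 1)} : Set (EuclideanSpace ℝ (Fin n))) =
        {u | u ∈ X ∧ ∀ v ∈ X,
          η (t + 1) * (∑ i ∈ Finset.Icc 1 t, ⟪g i + p' i, u⟫) - ⟪Φ' (x 1), u⟫ + Φ u ≤
          η (t + 1) * (∑ i ∈ Finset.Icc 1 t, ⟪g i + p' i, v⟫) - ⟪Φ' (x 1), v⟫ + Φ v} := by
  classical
  set p' : ℕ → EuclideanSpace ℝ (Fin n) := fun t =>
    if t ≤ 1 then 0 else (η t)⁻¹ • (Φ' (y t) - Φ' (x t)) with hp'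
  have hp1 : p' 1 = 0 := by simp [hp']
  have hps : ∀ t, 1 ≤ t → η (t + 1) • p' (t + 1) = Φ' (y (t + 1)) - Φ' (x (t + 1)) := by
    intro t ht
    have : ¬ (t + 1 ≤ 1) := by omega
    simp only [hp', this, if_false]
    rw [smul_smul, mul_inv_cancel₀ (hη _).ne', one_smul]
  have hN : ∀ t, 1 ≤ t → η t • p' t ∈ normalCone X (x t) := by
    intro t ht
    rcases Nat.exists_eq_add_of_le' ht with ⟨k, rfl⟩
    rcases Nat.eq_zero_or_pos k with rfl | hk
    · intro z _
      simp [hp1]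
    · rw [hps k hk]
      have hxx := hx (k + 1) ht
      exact aux_normal X Φ Φ' hXconv _ _ (hΦgrad _ hxx.2) hxx.1 (hproj k hk)
  have hsum : ∀ t, Φ' (x 1) - Φ' (x (t + 1)) =
      η (t + 1) • (∑ i ∈ Finset.Icc 1 t, (g i + p' i)) + η (t + 1) • p' (t + 1) := by
    intro t
    induction t with
    | zero => simp [hp1]
    | succ k ih =>
      rw [Finset.sum_Icc_succ_top (by omega), hps (k + 1) (by omega),
        hystep (k + 1) (by omega), hwstep (k + 1) (by omega), hγ]
      have hne := (hη (k + 1)).ne'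
      have e : Φ' (x (k + 1)) = Φ' (x 1) - (η (k + 1) • (∑ i ∈ Finset.Icc 1 k, (g i + p' i))
          + η (k + 1) • p' (k + 1)) := by rw [← ih]; abel
      rw [e]
      match_scalars <;> field_simp <;> ring
  refine ⟨p', ?_, ?_⟩
  · intro t ht z hz
    have := hN t ht z hz
    rw [real_inner_smul_left] at this
    exact nonpos_of_mul_nonpos_right this (hη t)
  · intro t
    have hxx := hx (t + 1) (by omega)
    have hval : ∀ u : EuclideanSpace ℝ (Fin n),
        η (t + 1) * (∑ i ∈ Finset.Icc 1 t, ⟪g i + p' i, u⟫) - ⟪Φ' (x 1), u⟫ =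
        - ⟪η (t + 1) • p' (t + 1), u⟫ - ⟪Φ' (x (t + 1)), u⟫ := by
      intro u
      have := congrArg (fun q => ⟪q, u⟫) (hsum t)
      simp only [inner_sub_left, inner_add_left, real_inner_smul_left, sum_inner] at this
      simp only [inner_add_left, real_inner_smul_left]
      linarith
    have hstrict : ∀ v ∈ X, v ≠ x (t + 1) →
        - ⟪η (t + 1) • p' (t + 1), x (t + 1)⟫ - ⟪Φ' (x (t + 1)), x (t + 1)⟫ + Φ (x (t + 1)) <
        - ⟪η (t + 1) • p' (t + 1), v⟫ - ⟪Φ' (x (t + 1)), v⟫ + Φ v := by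
      intro v hv hne
      have h1 := hN (t + 1) (by omega) v hv
      have h2 := aux_grad_strict D Φ hDopen hDconv hΦconv hΦstrict _ _ v
        (hΦgrad _ hxx.2) hxx.2 (hXsub hv) hne
      rw [inner_sub_right] at h1 h2
      linarith
    ext u
    simp only [Set.mem_singleton_iff, Set.mem_ofPred_eq, hval]
    constructor
    · rintro rfl
      refine ⟨hxx.1, fun v hv => ?_⟩
      by_cases hne : v = x (t + 1)
      · rw [hne]
      · exact (hstrict v hv hne).le
    · rintro ⟨hu, hmin⟩
      by_contra hne
      exact absurd (hmin _ hxx.1) (not_le.2 (hstrict u hu hne))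
end

section
/- Equivalence of dual-stabilized OMD and dual averaging when D ∩ X lies in the relative interior of X (Corollary 5). Assume D ∩ X ⊆ relint X. Let η : ℕ → ℝ_{>0} be nonincreasing, γ_t := η_{t+1}/η_t, let x_1 ∈ X ∩ D and let {g_t}_{t≥1} ⊆ ℝⁿ be any sequence. Let {x_t}_{t≥1} be the DS-OMD iterates: for t ≥ 1, ∇Φ(w_{t+1}) = ∇Φ(x_t) − η_t g_t with w_{t+1} ∈ D; ∇Φ(y_{t+1}) = γ_t ∇Φ(w_{t+1}) + (1−γ_t) ∇Φ(x_1) with y_{t+1} ∈ D; and x_{t+1} ∈ X ∩ D satisfies D_Φ(x_{t+1}, y_{t+1}) ≤ D_Φ(x, y_{t+1}) for all x ∈ X. Let {x'_t}_{t≥1} be the DA iterates: x'_1 = x_1 and for t ≥ 1, ∇Φ(y'_{t+1}) = ∇Φ(x_1) − η_{t+1} Σ_{i=1}^t g_i with y'_{t+1} ∈ D, and x'_{t+1} ∈ X ∩ D satisfies D_Φ(x'_{t+1}, y'_{t+1}) ≤ D_Φ(x, y'_{t+1}) for all x ∈ X. Then x_t = x'_t for every t ≥ 1. -/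
/-! Equivalence of dual-stabilized OMD and dual averaging when `D ∩ X` lies in
the relative interior of `X` (Corollary 5). -/

open scoped RealInnerProductSpace BigOperators

open scoped RealInnerProductSpace BigOperators

theorem aux_deriv {n : ℕ} (Φ : EuclideanSpace ℝ (Fin n) → ℝ) (G a d : EuclideanSpace ℝ (Fin n))
    (s : ℝ) (h : HasGradientAt Φ G (a + s • d)) :
    HasDerivAt (fun r : ℝ => Φ (a + r • d)) ⟪G, d⟫ s := by
  have h1 : HasDerivAt (fun r : ℝ => a + r • d) d s := by
    simpa using ((hasDerivAt_id s).smul_const d).const_add a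
  have h2 := (h.hasFDerivAt).comp_hasDerivAt s h1
  have e : (InnerProductSpace.toDual ℝ _ G) d = ⟪G, d⟫ := by simp
  rw [e] at h2
  exact h2

theorem aux_orth {n : ℕ} (X : Set (EuclideanSpace ℝ (Fin n)))
    (Φ : EuclideanSpace ℝ (Fin n) → ℝ)
    (Φ' : EuclideanSpace ℝ (Fin n) → EuclideanSpace ℝ (Fin n))
    (a b : EuclideanSpace ℝ (Fin n)) (ha : a ∈ intrinsicInterior ℝ X)
    (hg : HasGradientAt Φ (Φ' a) a)
    (hmin : ∀ u ∈ X, bregman Φ Φ' a b ≤ bregman Φ Φ' u b) (u : EuclideanSpace ℝ (Fin n))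
    (hu : u ∈ X) : ⟪Φ' a, u - a⟫ = ⟪Φ' b, u - a⟫ := by
  have hev : ∀ᶠ r : ℝ in nhds 0, a + r • (u - a) ∈ X := by
    obtain ⟨p, hp, rfl⟩ := mem_intrinsicInterior.1 ha
    have hmem : ∀ r : ℝ, (p : EuclideanSpace ℝ (Fin n)) + r • (u - p) ∈ affineSpan ℝ X := by
      intro r
      have := AffineMap.lineMap_mem r p.2 (subset_affineSpan ℝ X hu)
      rw [AffineMap.lineMap_apply] at this
      simpa [add_comm] using this
    let f : ℝ → affineSpan ℝ X := fun r => ⟨p + r • (u - p), hmem r⟩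
    have hf : Continuous f := by
      apply Continuous.subtype_mk
      fun_prop
    have hf0 : f 0 = p := by
      apply Subtype.ext
      simp [f]
    have : f ⁻¹' (interior ((↑) ⁻¹' X)) ∈ nhds (0 : ℝ) := by
      apply hf.continuousAt.preimage_mem_nhds
      rw [hf0]
      exact isOpen_interior.mem_nhds hp
    filter_upwards [this] with r hr
    exact (interior_subset hr : _)
  have hd := aux_deriv Φ (Φ' a) a (u - a) 0 (by simpa using hg)
  have hd2 : HasDerivAt (fun r : ℝ => Φ (a + r • (u - a)) - r * ⟪Φ' b, u - a⟫)
      (⟪Φ' a, u - a⟫ - ⟪Φ' b, u - a⟫) 0 := by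
    have h3 := hd.sub ((hasDerivAt_id (0 : ℝ)).mul_const ⟪Φ' b, u - a⟫)
    rw [one_mul] at h3
    exact h3
  have hl : IsLocalMin (fun r : ℝ => Φ (a + r • (u - a)) - r * ⟪Φ' b, u - a⟫) 0 := by
    filter_upwards [hev] with r hr
    have := hmin _ hr
    unfold bregman at this
    have e : a + r • (u - a) - b = (a - b) + r • (u - a) := by abel
    rw [e, inner_add_right, inner_smul_right] at this
    simp only [zero_smul, add_zero, zero_mul, sub_zero]
    linarith
  have := hl.hasDerivAt_eq_zero hd2
  linarith

theorem aux_strict {n : ℕ} (D : Set (EuclideanSpace ℝ (Fin n)))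
    (Φ : EuclideanSpace ℝ (Fin n) → ℝ)
    (Φ' : EuclideanSpace ℝ (Fin n) → EuclideanSpace ℝ (Fin n))
    (hΦstrict : StrictConvexOn ℝ D Φ)
    (hΦgrad : ∀ y ∈ D, HasGradientAt Φ (Φ' y) y)
    (a b : EuclideanSpace ℝ (Fin n)) (ha : a ∈ D) (hb : b ∈ D)
    (h : ⟪Φ' a, b - a⟫ = ⟪Φ' b, b - a⟫) : a = b := by
  by_contra hab
  have hS : StrictConvexOn ℝ (Set.Icc (0 : ℝ) 1) (fun r : ℝ => Φ (a + r • (b - a))) := by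
    refine ⟨convex_Icc _ _, ?_⟩
    intro p hp q hq hpq c e hc he hce
    have hm : ∀ r ∈ Set.Icc (0 : ℝ) 1, a + r • (b - a) ∈ D := fun r hr =>
      hΦstrict.1.add_smul_sub_mem ha hb hr
    have hne : a + p • (b - a) ≠ a + q • (b - a) := by
      intro hh
      have h3 := smul_left_injective ℝ (sub_ne_zero.2 (Ne.symm hab)) (add_left_cancel hh)
      exact hpq h3
    have := hΦstrict.2 (hm p hp) (hm q hq) hne hc he hce
    have e1 : c • (a + p • (b - a)) + e • (a + q • (b - a))
        = a + (c • p + e • q) • (b - a) := by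
      have : c = 1 - e := by linarith
      subst this
      simp only [smul_eq_mul]
      module
    rw [e1] at this
    exact this
  have h0 := aux_deriv Φ (Φ' a) a (b - a) 0 (by simpa using hΦgrad a ha)
  have h1 := aux_deriv Φ (Φ' b) a (b - a) 1 (by simpa using hΦgrad b hb)
  have l0 := hS.lt_slope_of_hasDerivAt (by simp) (by simp) one_pos h0
  have l1 := hS.slope_lt_of_hasDerivAt (by simp) (by simp) one_pos h1
  linarith

theorem ds_omd_eq_dual_averaging {n : ℕ}
    (D X : Set (EuclideanSpace ℝ (Fin n)))
    (Φ : EuclideanSpace ℝ (Fin n) → ℝ)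
    (Φ' : EuclideanSpace ℝ (Fin n) → EuclideanSpace ℝ (Fin n))
    -- mirror map setup
    (hDopen : IsOpen D) (hDconv : Convex ℝ D) (hDne : D.Nonempty)
    (hΦconv : ConvexOn ℝ (closure D) Φ)
    (hΦstrict : StrictConvexOn ℝ D Φ)
    (hΦgrad : ∀ y ∈ D, HasGradientAt Φ (Φ' y) y)
    (hΦbij : Set.BijOn Φ' D Set.univ)
    (hXclosed : IsClosed X) (hXconv : Convex ℝ X)
    (hXsub : X ⊆ closure D) (hXDne : (X ∩ D).Nonempty)
    -- `D ∩ X` lies in the relative interior of `X`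
    (hrelint : D ∩ X ⊆ intrinsicInterior ℝ X)
    -- learning rates and stabilization parameters
    (η : ℕ → ℝ) (hη : ∀ t, 0 < η t) (hηmono : ∀ t, η (t + 1) ≤ η t)
    (γ : ℕ → ℝ) (hγ : ∀ t, γ t = η (t + 1) / η t)
    -- subgradients
    (g : ℕ → EuclideanSpace ℝ (Fin n))
    -- DS-OMD iterates
    (x w y : ℕ → EuclideanSpace ℝ (Fin n))
    (hx1 : x 1 ∈ X ∩ D)
    (hx : ∀ t, 1 ≤ t → x t ∈ X ∩ D)
    (hw : ∀ t, 2 ≤ t → w t ∈ D)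
    (hy : ∀ t, 2 ≤ t → y t ∈ D)
    (hwstep : ∀ t, 1 ≤ t → Φ' (w (t + 1)) = Φ' (x t) - η t • g t)
    (hystep : ∀ t, 1 ≤ t →
      Φ' (y (t + 1)) = γ t • Φ' (w (t + 1)) + (1 - γ t) • Φ' (x 1))
    (hproj : ∀ t, 1 ≤ t → ∀ u ∈ X,
      bregman Φ Φ' (x (t + 1)) (y (t + 1)) ≤ bregman Φ Φ' u (y (t + 1)))
    -- DA iterates
    (x' y' : ℕ → EuclideanSpace ℝ (Fin n))
    (hx'1 : x' 1 = x 1)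
    (hx' : ∀ t, 1 ≤ t → x' t ∈ X ∩ D)
    (hy' : ∀ t, 2 ≤ t → y' t ∈ D)
    (hy'step : ∀ t, 1 ≤ t →
      Φ' (y' (t + 1)) = Φ' (x 1) - η (t + 1) • ∑ i ∈ Finset.Icc 1 t, g i)
    (hproj' : ∀ t, 1 ≤ t → ∀ u ∈ X,
      bregman Φ Φ' (x' (t + 1)) (y' (t + 1)) ≤ bregman Φ Φ' u (y' (t + 1))) :
    ∀ t, 1 ≤ t → x t = x' t := by
  have key : ∀ t, 1 ≤ t → ∀ u ∈ X, ∀ v ∈ X,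
      ⟪Φ' (x t), u - v⟫ = ⟪Φ' (x 1) - η t • ∑ i ∈ Finset.Ico 1 t, g i, u - v⟫ := by
    intro t ht
    induction t, ht using Nat.le_induction with
    | base => simp
    | succ t ht ih =>
      intro u hu v hv
      have hxt := hx (t + 1) (by omega)
      have o := aux_orth X Φ Φ' _ _ (hrelint ⟨hxt.2, hxt.1⟩) (hΦgrad _ hxt.2) (hproj t ht)
      have ou := o u hu
      have ov := o v hv
      have i1 := ih u hu v hv
      rw [hystep t ht, hwstep t ht] at ou ov
      rw [Finset.sum_Ico_succ_top ht]
      have hgm : γ t * η t = η (t + 1) := by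
        rw [hγ]; exact div_mul_cancel₀ _ (hη t).ne'
      rw [← hgm]
      simp only [inner_sub_left, inner_sub_right, inner_add_left, inner_smul_left,
        RCLike.conj_to_real] at *
      linear_combination ou - ov + γ t * i1
  intro t ht
  obtain rfl | ht1 := Nat.eq_or_lt_of_le ht
  · exact hx'1.symm
  obtain ⟨t, rfl⟩ : ∃ s, t = s + 1 := ⟨t - 1, by omega⟩
  have ht' : 1 ≤ t := by omega
  have hxt := hx (t + 1) ht
  have hxt' := hx' (t + 1) ht
  apply aux_strict D Φ Φ' hΦstrict hΦgrad _ _ hxt.2 hxt'.2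
  have o := aux_orth X Φ Φ' _ _ (hrelint ⟨hxt'.2, hxt'.1⟩) (hΦgrad _ hxt'.2) (hproj' t ht')
    _ hxt.1
  have k := key (t + 1) ht _ hxt'.1 _ hxt.1
  rw [hy'step t ht'] at o
  have hI : Finset.Ico 1 (t + 1) = Finset.Icc 1 t := by
    ext i; simp only [Finset.mem_Ico, Finset.mem_Icc]; omega
  rw [hI] at k
  rw [k, ← neg_sub (x (t + 1)) (x' (t + 1)), inner_neg_right, inner_neg_right, o]
end

section
/- Self-confident step-size summation inequality (auxiliary proposition used in the first-order regret bound). Let u > 0 and let a_1, …, a_T be reals with 0 ≤ a_t ≤ u for all t. Write A_t := Σ_{i=1}^t a_i (with A_0 := 0). Then Σ_{t=1}^T a_t / √(u + A_{t−1}) ≤ 2√(A_T). -/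
/-! Self-confident step-size summation inequality (auxiliary proposition used
in the first-order regret bound): if `0 ≤ a_t ≤ u` and `A_t = Σ_{i≤t} a_i`,
then `Σ_{t=1}^T a_t / √(u + A_{t−1}) ≤ 2√(A_T)`. -/

open scoped BigOperators

theorem self_confident_sum_bound (u : ℝ) (hu : 0 < u) (T : ℕ) (a : ℕ → ℝ)
    (ha : ∀ t ∈ Finset.Icc 1 T, 0 ≤ a t ∧ a t ≤ u) :
    ∑ t ∈ Finset.Icc 1 T, a t / Real.sqrt (u + ∑ i ∈ Finset.Icc 1 (t - 1), a i)
      ≤ 2 * Real.sqrt (∑ i ∈ Finset.Icc 1 T, a i) := by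
  induction T with
  | zero => simp
  | succ n ih =>
    have ih' := ih (fun t ht => ha t (by
      rw [Finset.mem_Icc] at ht ⊢
      omega))
    obtain ⟨h0, h1⟩ := ha (n + 1) (by simp)
    have hS : 0 ≤ ∑ i ∈ Finset.Icc 1 n, a i := Finset.sum_nonneg (fun t ht => (ha t (by
      rw [Finset.mem_Icc] at ht ⊢
      omega)).1)
    rw [Finset.sum_Icc_succ_top (by omega), Finset.sum_Icc_succ_top (by omega)]
    simp only [Nat.add_sub_cancel]
    set S := ∑ i ∈ Finset.Icc 1 n, a i
    have key : a (n + 1) / Real.sqrt (u + S)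
        ≤ 2 * (Real.sqrt (S + a (n + 1)) - Real.sqrt S) := by
      have hr : 0 < Real.sqrt (u + S) := Real.sqrt_pos.mpr (by linarith)
      rw [div_le_iff₀ hr]
      have hpq : Real.sqrt S ≤ Real.sqrt (S + a (n + 1)) := Real.sqrt_le_sqrt (by linarith)
      have hqr : Real.sqrt (S + a (n + 1)) ≤ Real.sqrt (u + S) := Real.sqrt_le_sqrt (by linarith)
      have e1 := Real.sq_sqrt hS
      have e2 := Real.sq_sqrt (show 0 ≤ S + a (n + 1) by linarith)
      have h := mul_le_mul_of_nonneg_left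
        (show Real.sqrt (S + a (n + 1)) + Real.sqrt S ≤ 2 * Real.sqrt (u + S) by linarith)
        (sub_nonneg.mpr hpq)
      nlinarith [h, e1, e2]
    linarith
end
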